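/- arXiv:2604.21122 — 5 statements merged into one kernel-verified Lean document; each statement's English description precedes it below -/
import Mathlib

section
/- Let ε > 0. There is a constant C(ε) > 0 such that for all real X, D ≥ 1 and any complex numbers ξ_n indexed by integers n ∈ [X, 2X], one has ∑_{d ∈ [D,2D] ∩ ℤ} | ∑_{n ∈ [X,2X] ∩ ℤ, n | d} ξ_n |^2 ≤ C(ε) · (D·X^{ε−1} + X) · ∑_{n ∈ [X,2X] ∩ ℤ} |ξ_n|^2. -/
open Finset

/-- The divisor bound: `d(n) ≪ n ^ ε`. -/
theorem exists_card_divisors_le_mul_rpow {ε : ℝ} (hε : 0 < ε) :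
    ∃ C : ℝ, 0 < C ∧ ∀ n : ℕ, n ≠ 0 → (#n.divisors : ℝ) ≤ C * (n : ℝ) ^ ε := by
  set K : ℝ := 1 + 1 / (ε * Real.log 2) with hK
  have hlog : 0 < ε * Real.log 2 := mul_pos hε (Real.log_pos one_lt_two)
  have hK1 : 1 ≤ K := by rw [hK]; linarith [one_div_pos.2 hlog]
  obtain ⟨N, hN⟩ := exists_nat_ge ((2 : ℝ) ^ (1 / ε))
  refine ⟨K ^ N, by positivity, fun n hn => ?_⟩
  have local_bound : ∀ p ∈ n.primeFactors, ((n.factorization p : ℝ) + 1) ≤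
      (if p < N then K else 1) * ((p : ℝ) ^ n.factorization p) ^ ε := by
    intro p hp
    have h2p : (2 : ℝ) ≤ p := by exact_mod_cast (Nat.prime_of_mem_primeFactors hp).two_le
    set a := n.factorization p
    rw [← Real.rpow_natCast, ← Real.rpow_mul (by positivity)]
    split_ifs with hpN
    · have h1 : 1 + a * (ε * Real.log 2) ≤ (p : ℝ) ^ ((a : ℝ) * ε) := by
        calc 1 + a * (ε * Real.log 2) ≤ Real.exp (a * (ε * Real.log 2)) := by
              linarith [Real.add_one_le_exp (a * (ε * Real.log 2))]
          _ = (2 : ℝ) ^ ((a : ℝ) * ε) := by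
              rw [Real.rpow_def_of_pos two_pos]; ring_nf
          _ ≤ _ := Real.rpow_le_rpow two_pos.le h2p (by positivity)
      have h2 : (a : ℝ) + 1 ≤ K * (1 + a * (ε * Real.log 2)) := by
        have h3 : K * (1 + a * (ε * Real.log 2)) =
            1 + a + (1 / (ε * Real.log 2) + a * (ε * Real.log 2)) := by
          rw [hK]; field_simp; ring
        rw [h3]
        have : 0 ≤ 1 / (ε * Real.log 2) + a * (ε * Real.log 2) := by positivity
        linarith
      exact h2.trans (mul_le_mul_of_nonneg_left h1 (by positivity))
    · have hpN' : (2 : ℝ) ^ (1 / ε) ≤ p := hN.trans (by exact_mod_cast not_lt.1 hpN)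
      have h1 : (2 : ℝ) ≤ (p : ℝ) ^ ε := by
        calc (2 : ℝ) = ((2 : ℝ) ^ (1 / ε)) ^ ε := by
              rw [← Real.rpow_mul two_pos.le, one_div_mul_cancel hε.ne', Real.rpow_one]
          _ ≤ _ := Real.rpow_le_rpow (by positivity) hpN' hε.le
      rw [one_mul, mul_comm, Real.rpow_mul (by positivity), Real.rpow_natCast]
      calc (a : ℝ) + 1 ≤ 2 ^ a := by exact_mod_cast Nat.lt_two_pow_self (n := a)
        _ ≤ _ := pow_le_pow_left₀ two_pos.le h1 a
  have small_bound : ∏ p ∈ n.primeFactors, (if p < N then K else 1) ≤ K ^ N := by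
    rw [← prod_filter, prod_const]
    refine pow_le_pow_right₀ hK1 ?_
    calc #{p ∈ n.primeFactors | p < N} ≤ #(range N) :=
          card_le_card fun p hp => by simpa using (mem_filter.1 hp).2
      _ = N := card_range N
  calc (#n.divisors : ℝ) = ∏ p ∈ n.primeFactors, ((n.factorization p : ℝ) + 1) := by
        rw [Nat.card_divisors hn]; push_cast; rfl
    _ ≤ ∏ p ∈ n.primeFactors,
        (if p < N then K else 1) * ((p : ℝ) ^ n.factorization p) ^ ε :=
        prod_le_prod (fun _ _ => by positivity) local_bound
    _ = (∏ p ∈ n.primeFactors, (if p < N then K else 1)) * (n : ℝ) ^ ε := by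
        rw [prod_mul_distrib, Real.finsetProd_rpow _ _ fun _ _ => by positivity]
        congr 2
        exact_mod_cast Nat.prod_factorization_pow_eq_self hn
    _ ≤ K ^ N * (n : ℝ) ^ ε := by gcongr

theorem card_filter_dvd_Icc_floor_le {a r : ℤ} {B : ℝ} (ha : 0 < a) (hr : 0 < r) (hB : 0 ≤ B) :
    (#{x ∈ Icc a ⌊B⌋ | r ∣ x} : ℝ) ≤ B / r := by
  have hr' : (0 : ℝ) < r := by exact_mod_cast hr
  have hsub : {x ∈ Icc a ⌊B⌋ | r ∣ x} ⊆ {x ∈ Ioc 0 ⌊B⌋ | r ∣ x} := by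
    refine filter_subset_filter _ fun x hx => ?_
    rw [mem_Icc] at hx
    exact mem_Ioc.2 ⟨ha.trans_le hx.1, hx.2⟩
  have hcard := Int.Ioc_filter_dvd_card 0 ⌊B⌋ hr
  have hfloor : ((⌊(⌊B⌋ : ℚ) / (r : ℚ)⌋ : ℤ) : ℝ) ≤ B / r := by
    have h1 : ((⌊(⌊B⌋ : ℚ) / (r : ℚ)⌋ : ℤ) : ℝ) ≤ (⌊B⌋ : ℝ) / r := by
      exact_mod_cast Int.floor_le ((⌊B⌋ : ℚ) / (r : ℚ))
    exact h1.trans (by gcongr; exact Int.floor_le B)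
  calc (#{x ∈ Icc a ⌊B⌋ | r ∣ x} : ℝ) ≤ #{x ∈ Ioc 0 ⌊B⌋ | r ∣ x} := by
        exact_mod_cast card_le_card hsub
    _ = ((max (⌊(⌊B⌋ : ℚ) / (r : ℚ)⌋ - ⌊((0 : ℤ) : ℚ) / (r : ℚ)⌋) 0 : ℤ) : ℝ) := by
        exact_mod_cast hcard
    _ ≤ B / r := by
        rw [Int.cast_max]
        refine max_le (by simpa using hfloor) (by simpa using by positivity)

theorem sum_gcd_Icc_floor_le {a n : ℤ} {B : ℝ} (ha : 0 < a) (hn : n ≠ 0) (hB : 0 ≤ B) :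
    ∑ m ∈ Icc a ⌊B⌋, (Int.gcd n m : ℝ) ≤ #n.natAbs.divisors * B := by
  calc ∑ m ∈ Icc a ⌊B⌋, (Int.gcd n m : ℝ)
      ≤ ∑ m ∈ Icc a ⌊B⌋, ∑ g ∈ n.natAbs.divisors, if (g : ℤ) ∣ m then (g : ℝ) else 0 := by
        refine sum_le_sum fun m _ => ?_
        have hmem : Int.gcd n m ∈ n.natAbs.divisors := by
          rw [Nat.mem_divisors]
          exact ⟨Nat.gcd_dvd_left _ _, by simpa using hn⟩
        have h := single_le_sum (f := fun g : ℕ => if (g : ℤ) ∣ m then (g : ℝ) else 0)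
          (fun g _ => by split_ifs <;> positivity) hmem
        simpa [Int.gcd_dvd_right] using h
    _ = ∑ g ∈ n.natAbs.divisors, (#{m ∈ Icc a ⌊B⌋ | (g : ℤ) ∣ m} : ℝ) * g := by
        rw [sum_comm]
        simp [← sum_filter]
    _ ≤ ∑ g ∈ n.natAbs.divisors, B := by
        refine sum_le_sum fun g hg => ?_
        have hg0 : 0 < g := Nat.pos_of_mem_divisors hg
        have hg' : (0 : ℝ) < g := by exact_mod_cast hg0
        have h := card_filter_dvd_Icc_floor_le (r := g) ha (by exact_mod_cast hg0) hB
        rw [Int.cast_natCast] at h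
        exact (le_div_iff₀ hg').1 h
    _ = #n.natAbs.divisors * B := by simp

theorem sum_sq_norm_sum_filter_dvd_le (S T : Finset ℤ) (ξ : ℤ → ℂ) :
    ∑ d ∈ T, ‖∑ n ∈ S with n ∣ d, ξ n‖ ^ 2 ≤
      ∑ n ∈ S, ‖ξ n‖ ^ 2 * ∑ m ∈ S, (#{d ∈ T | ((Int.lcm n m : ℕ) : ℤ) ∣ d} : ℝ) := by
  calc ∑ d ∈ T, ‖∑ n ∈ S with n ∣ d, ξ n‖ ^ 2
      ≤ ∑ d ∈ T, (#{m ∈ S | m ∣ d} : ℝ) * ∑ n ∈ S with n ∣ d, ‖ξ n‖ ^ 2 := by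
        refine sum_le_sum fun d _ => ?_
        exact (pow_le_pow_left₀ (norm_nonneg _) (norm_sum_le _ _) 2).trans
          sq_sum_le_card_mul_sum_sq
    _ = ∑ d ∈ T, ∑ n ∈ S, ∑ m ∈ S,
          ‖ξ n‖ ^ 2 * if ((Int.lcm n m : ℕ) : ℤ) ∣ d then 1 else 0 := by
        refine sum_congr rfl fun d _ => ?_
        rw [mul_comm, card_filter, Nat.cast_sum, sum_filter, sum_mul_sum]
        refine sum_congr rfl fun n _ => sum_congr rfl fun m _ => ?_
        have h : ((Int.lcm n m : ℕ) : ℤ) ∣ d ↔ n ∣ d ∧ m ∣ d := by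
          rw [Int.coe_lcm]; exact lcm_dvd_iff
        by_cases hn : n ∣ d <;> by_cases hm : m ∣ d <;> simp [h, hn, hm]
    _ = _ := by
        rw [sum_comm]
        refine sum_congr rfl fun n _ => ?_
        rw [sum_comm, mul_sum]
        refine sum_congr rfl fun m _ => ?_
        rw [← mul_sum, card_filter]
        push_cast
        rfl

theorem sum_card_filter_lcm_dvd_le {X D : ℝ} (hX : 1 ≤ X) (hD : 1 ≤ D) {n : ℤ}
    (hn : n ∈ Icc ⌈X⌉ ⌊2 * X⌋) :
    ∑ m ∈ Icc ⌈X⌉ ⌊2 * X⌋, (#{d ∈ Icc ⌈D⌉ ⌊2 * D⌋ | ((Int.lcm n m : ℕ) : ℤ) ∣ d} : ℝ) ≤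
      4 * D / X * #n.natAbs.divisors := by
  have hX0 : 0 < X := one_pos.trans_le hX
  have hD0 : 0 < D := one_pos.trans_le hD
  have hcX : 0 < ⌈X⌉ := Int.ceil_pos.2 hX0
  have le_of_mem : ∀ m ∈ Icc ⌈X⌉ ⌊2 * X⌋, X ≤ m := fun m hm => Int.ceil_le.1 (mem_Icc.1 hm).1
  have pos_of_mem : ∀ m ∈ Icc ⌈X⌉ ⌊2 * X⌋, 0 < m := fun m hm => hcX.trans_le (mem_Icc.1 hm).1
  have hn0 := pos_of_mem n hn
  calc ∑ m ∈ Icc ⌈X⌉ ⌊2 * X⌋, (#{d ∈ Icc ⌈D⌉ ⌊2 * D⌋ | ((Int.lcm n m : ℕ) : ℤ) ∣ d} : ℝ)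
      ≤ ∑ m ∈ Icc ⌈X⌉ ⌊2 * X⌋, 2 * D / X ^ 2 * (Int.gcd n m : ℝ) := by
        refine sum_le_sum fun m hm => ?_
        have hm0 := pos_of_mem m hm
        have hl : 0 < Int.lcm n m := Int.lcm_pos hn0.ne' hm0.ne'
        have hl' : (0 : ℝ) < Int.lcm n m := by exact_mod_cast hl
        have hcard := card_filter_dvd_Icc_floor_le (r := (Int.lcm n m : ℕ)) (Int.ceil_pos.2 hD0)
          (by exact_mod_cast hl) (by positivity : 0 ≤ 2 * D)
        rw [Int.cast_natCast] at hcard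
        refine hcard.trans ?_
        have hprod : (Int.gcd n m : ℝ) * Int.lcm n m = n * m := by
          have h : ((Int.gcd n m * Int.lcm n m : ℕ) : ℤ) = n * m := by
            rw [Int.gcd_mul_lcm, Nat.cast_mul, Int.natCast_natAbs, Int.natCast_natAbs,
              abs_of_pos hn0, abs_of_pos hm0]
          exact_mod_cast h
        have hXX : X ^ 2 ≤ Int.gcd n m * Int.lcm n m := by
          rw [hprod, sq]
          exact mul_le_mul (le_of_mem n hn) (le_of_mem m hm) hX0.le (by exact_mod_cast hn0.le)
        rw [div_le_iff₀ hl', div_mul_eq_mul_div, div_mul_eq_mul_div, le_div_iff₀ (by positivity),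
          mul_assoc (2 * D)]
        gcongr
    _ = 2 * D / X ^ 2 * ∑ m ∈ Icc ⌈X⌉ ⌊2 * X⌋, (Int.gcd n m : ℝ) := by rw [mul_sum]
    _ ≤ 2 * D / X ^ 2 * (#n.natAbs.divisors * (2 * X)) := by
        gcongr
        exact sum_gcd_Icc_floor_le hcX hn0.ne' (by positivity)
    _ = _ := by field_simp; ring

theorem dual_large_sieve_inequality (ε : ℝ) (hε : 0 < ε) :
    ∃ C : ℝ, 0 < C ∧
      ∀ (X D : ℝ), 1 ≤ X → 1 ≤ D → ∀ ξ : ℤ → ℂ,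
        ∑ d ∈ Finset.Icc ⌈D⌉ ⌊2 * D⌋,
            ‖∑ n ∈ (Finset.Icc ⌈X⌉ ⌊2 * X⌋).filter (fun n => n ∣ d), ξ n‖ ^ 2 ≤
          C * (D * X ^ (ε - 1) + X) * ∑ n ∈ Finset.Icc ⌈X⌉ ⌊2 * X⌋, ‖ξ n‖ ^ 2 := by
  obtain ⟨C, hC, hdiv⟩ := exists_card_divisors_le_mul_rpow hε
  refine ⟨4 * C * 2 ^ ε, by positivity, fun X D hX hD ξ => ?_⟩
  have hX0 : 0 < X := one_pos.trans_le hX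
  have hD0 : 0 < D := one_pos.trans_le hD
  refine (sum_sq_norm_sum_filter_dvd_le _ _ ξ).trans ?_
  rw [mul_comm (4 * C * 2 ^ ε * _), sum_mul]
  refine sum_le_sum fun n hn => mul_le_mul_of_nonneg_left ?_ (by positivity)
  have hn0 : 0 < n := (Int.ceil_pos.2 hX0).trans_le (mem_Icc.1 hn).1
  have hn2 : (n.natAbs : ℝ) ≤ 2 * X := by
    rw [Nat.cast_natAbs, abs_of_pos hn0]
    exact Int.le_floor.1 (mem_Icc.1 hn).2
  calc _ ≤ 4 * D / X * #n.natAbs.divisors := sum_card_filter_lcm_dvd_le hX hD hn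
    _ ≤ 4 * D / X * (C * (2 * X) ^ ε) := by
        gcongr
        exact (hdiv _ (Int.natAbs_ne_zero.2 hn0.ne')).trans (by gcongr)
    _ = 4 * C * 2 ^ ε * (D * X ^ (ε - 1)) := by
        rw [Real.mul_rpow two_pos.le hX0.le, Real.rpow_sub_one hX0.ne']
        ring
    _ ≤ _ := by
        gcongr
        linarith
end

section
/- Let k ≥ 2 be an integer and η > 0. There is a constant C(k,η) > 0 such that the following holds. Let X_1, …, X_k ∈ [1,∞), set X_1' = min(X_1, …, X_k), let A_1, …, A_k be finite sets of integers with A_i ⊆ [X_i, 2X_i], and for a positive integer d let A_{i,d} = {n ∈ A_i : d | n}. Then for every real Δ with 1 ≤ Δ ≤ 2X_1', one has ∑_{d ∈ [Δ,2Δ] ∩ ℤ} ∏_{i=1}^k |A_{i,d}| ≤ C(k,η) · Δ^{-(k-1)+2η} · (∏_{i=1}^k X_i^{(k-1)/k}) · (∏_{i=1}^k |A_i|^{1/k}). -/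
open Finset

theorem exists_card_divisors_le_rpow {δ : ℝ} (hδ : 0 < δ) :
    ∃ C : ℝ, 0 < C ∧ ∀ n : ℕ, n ≠ 0 → (#n.divisors : ℝ) ≤ C * (n : ℝ) ^ δ := by
  set c : ℝ := max 1 (1 / (δ * Real.log 2)) with hc
  have hl : 0 < Real.log 2 := Real.log_pos one_lt_two
  have hc1 : 1 ≤ c := le_max_left _ _
  have hcδ : 1 ≤ c * (δ * Real.log 2) := by
    rw [← div_le_iff₀ (by positivity)]
    exact le_max_right _ _
  set N : ℕ := ⌈(2 : ℝ) ^ (1 / δ)⌉₊ with hN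
  have key : ∀ p : ℕ, p.Prime → ∀ a : ℕ,
      ((a : ℝ) + 1) ≤ (if p < N then c else 1) * ((p : ℝ) ^ a) ^ δ := by
    intro p hp a
    have hp2 : (2 : ℝ) ≤ p := by exact_mod_cast hp.two_le
    have hcomm : ((p : ℝ) ^ a) ^ δ = ((p : ℝ) ^ δ) ^ a := by
      rw [← Real.rpow_natCast, ← Real.rpow_mul (by positivity), mul_comm,
        Real.rpow_mul (by positivity), Real.rpow_natCast]
    split_ifs with h
    · have h2 : ((2 : ℝ) ^ a) ^ δ ≤ ((p : ℝ) ^ a) ^ δ := by gcongr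
      have h3 : (a : ℝ) * (δ * Real.log 2) + 1 ≤ ((2 : ℝ) ^ a) ^ δ := by
        rw [← Real.rpow_natCast, ← Real.rpow_mul (by positivity),
          Real.rpow_def_of_pos (by norm_num)]
        convert Real.add_one_le_exp _ using 2
        ring
      calc (a : ℝ) + 1 ≤ a * (c * (δ * Real.log 2)) + c := by
            gcongr
            exact le_mul_of_one_le_right (by positivity) hcδ
        _ = c * (a * (δ * Real.log 2) + 1) := by ring
        _ ≤ c * ((p : ℝ) ^ a) ^ δ := by gcongr; exact h3.trans h2
    · have h2 : (2 : ℝ) ≤ (p : ℝ) ^ δ := by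
        have : (2 : ℝ) ^ (1 / δ) ≤ p := (Nat.le_ceil _).trans (by exact_mod_cast not_lt.mp h)
        calc (2 : ℝ) = ((2 : ℝ) ^ (1 / δ)) ^ δ := by
              rw [← Real.rpow_mul (by norm_num), one_div_mul_cancel hδ.ne', Real.rpow_one]
          _ ≤ _ := by gcongr
      rw [hcomm, one_mul]
      calc (a : ℝ) + 1 ≤ 2 ^ a := by exact_mod_cast Nat.lt_two_pow_self
        _ ≤ _ := by gcongr
  refine ⟨c ^ N, by positivity, fun n hn => ?_⟩
  rw [Nat.card_divisors hn]
  have hprod : (∏ p ∈ n.primeFactors, ((p : ℝ) ^ n.factorization p) ^ δ) = (n : ℝ) ^ δ := by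
    rw [Real.finsetProd_rpow _ _ (fun _ _ => by positivity)]
    congr 1
    exact_mod_cast Nat.prod_factorization_pow_eq_self hn
  push_cast
  calc (∏ p ∈ n.primeFactors, ((n.factorization p : ℝ) + 1))
      ≤ ∏ p ∈ n.primeFactors,
          ((if p < N then c else 1) * ((p : ℝ) ^ n.factorization p) ^ δ) :=
        prod_le_prod (fun _ _ => by positivity)
          fun p hp => key p (Nat.prime_of_mem_primeFactors hp) _
    _ = c ^ #{p ∈ n.primeFactors | p < N} * (n : ℝ) ^ δ := by
        rw [prod_mul_distrib, hprod, ← prod_filter, prod_const]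
    _ ≤ c ^ N * (n : ℝ) ^ δ := by
        refine mul_le_mul_of_nonneg_right (pow_le_pow_right₀ hc1 ?_) (by positivity)
        calc #{p ∈ n.primeFactors | p < N} ≤ #(range N) :=
              card_le_card fun p hp => by simpa using (mem_filter.mp hp).2
          _ = N := card_range N

theorem sum_inv_lcm_le (m : ℕ) (hm : 1 ≤ m) :
    ∃ C : ℝ, 0 < C ∧ ∀ N : ℕ,
      ∑ t ∈ Fintype.piFinset (fun _ : Fin m => Ioc 0 N), (1 : ℝ) / (univ.lcm t : ℕ) ≤ C * N := by
  have hm0 : (0 : ℝ) < m := by exact_mod_cast hm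
  obtain ⟨C, hC, hτ⟩ := exists_card_divisors_le_rpow (δ := 1 / (2 * m ^ 2)) (by positivity)
  have hsum : Summable fun n : ℕ => ((n : ℝ) ^ (1 + 1 / (2 * m : ℝ)))⁻¹ := by
    rw [Real.summable_nat_rpow_inv]
    have : 0 < 1 / (2 * m : ℝ) := by positivity
    linarith
  set Z := ∑' n : ℕ, ((n : ℝ) ^ (1 + 1 / (2 * m : ℝ)))⁻¹ with hZ
  have hZ0 : 0 ≤ Z := tsum_nonneg fun n => by positivity
  refine ⟨C ^ m * (Z + 1), by positivity, fun N => ?_⟩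
  have hmaps : ∀ t ∈ Fintype.piFinset (fun _ : Fin m => Ioc 0 N),
      univ.lcm t ∈ Ioc 0 (N ^ m) := by
    intro t ht
    simp only [Fintype.mem_piFinset, mem_Ioc] at ht
    have hpos : 0 < ∏ i, t i := prod_pos fun i _ => (ht i).1
    have hdvd : univ.lcm t ∣ ∏ i, t i := Finset.lcm_dvd fun i hi => dvd_prod_of_mem t hi
    refine mem_Ioc.mpr ⟨Nat.pos_of_dvd_of_pos hdvd hpos, (Nat.le_of_dvd hpos hdvd).trans ?_⟩
    calc ∏ i, t i ≤ ∏ _i : Fin m, N := prod_le_prod' fun i _ => (ht i).2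
      _ = N ^ m := by simp
  rw [← sum_fiberwise_of_maps_to hmaps]
  have hterm : ∀ l ∈ Ioc 0 (N ^ m),
      ∑ t ∈ Fintype.piFinset (fun _ : Fin m => Ioc 0 N) with univ.lcm t = l,
        (1 : ℝ) / (univ.lcm t : ℕ) ≤ C ^ m * N * ((l : ℝ) ^ (1 + 1 / (2 * m : ℝ)))⁻¹ := by
    intro l hl
    obtain ⟨hl0, hlN⟩ := mem_Ioc.mp hl
    have hlpos : (0 : ℝ) < l := by exact_mod_cast hl0
    have hcard : #{t ∈ Fintype.piFinset (fun _ : Fin m => Ioc 0 N) | univ.lcm t = l}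
        ≤ #l.divisors ^ m := by
      calc _ ≤ #(Fintype.piFinset fun _ : Fin m => l.divisors) := by
            refine card_le_card fun t ht => ?_
            rw [mem_filter] at ht
            rw [Fintype.mem_piFinset]
            intro i
            exact Nat.mem_divisors.mpr ⟨ht.2 ▸ dvd_lcm (mem_univ i), hl0.ne'⟩
        _ = _ := by simp
    have hpow : (l : ℝ) ^ (1 / m : ℝ) ≤ N := by
      calc (l : ℝ) ^ (1 / m : ℝ) ≤ ((N : ℝ) ^ m) ^ (1 / m : ℝ) := by
            gcongr
            exact_mod_cast hlN
        _ = N := by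
            rw [one_div, Real.pow_rpow_inv_natCast (by positivity) (by omega)]
    calc _ = ∑ t ∈ Fintype.piFinset (fun _ : Fin m => Ioc 0 N) with univ.lcm t = l,
          (1 : ℝ) / l := sum_congr rfl fun t ht => by rw [(mem_filter.mp ht).2]
      _ = #{t ∈ Fintype.piFinset (fun _ : Fin m => Ioc 0 N) | univ.lcm t = l} * (1 / l : ℝ) := by
          rw [sum_const, nsmul_eq_mul]
      _ ≤ (#l.divisors : ℝ) ^ m * (1 / l : ℝ) := by gcongr; exact_mod_cast hcard
      _ ≤ (C * (l : ℝ) ^ (1 / (2 * m ^ 2) : ℝ)) ^ m * (1 / l : ℝ) := by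
          gcongr
          exact hτ l hl0.ne'
      _ = C ^ m * (l : ℝ) ^ (1 / m : ℝ) * ((l : ℝ) ^ (1 + 1 / (2 * m : ℝ)))⁻¹ := by
          rw [mul_pow, mul_assoc, mul_assoc, ← Real.rpow_natCast ((l : ℝ) ^ _),
            ← Real.rpow_mul hlpos.le, ← Real.rpow_neg hlpos.le, ← Real.rpow_add hlpos, one_div (l : ℝ),
            ← Real.rpow_neg_one (l : ℝ), ← Real.rpow_add hlpos]
          congr 2
          field_simp
          ring
      _ ≤ _ := by gcongr
  calc _ ≤ ∑ l ∈ Ioc 0 (N ^ m), C ^ m * N * ((l : ℝ) ^ (1 + 1 / (2 * m : ℝ)))⁻¹ :=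
        sum_le_sum hterm
    _ = C ^ m * N * ∑ l ∈ Ioc 0 (N ^ m), ((l : ℝ) ^ (1 + 1 / (2 * m : ℝ)))⁻¹ := by
        rw [mul_sum]
    _ ≤ C ^ m * N * (Z + 1) := by
        gcongr
        exact (hsum.sum_le_tsum _ fun _ _ => by positivity).trans (by linarith)
    _ = _ := by ring

theorem sum_card_filter_dvd_pow_le (m : ℕ) (hm : 1 ≤ m) :
    ∃ C : ℝ, 0 < C ∧ ∀ M N : ℕ,
      ∑ n ∈ Ioc 0 M, (#{d ∈ Ioc 0 N | d ∣ n} : ℝ) ^ m ≤ C * M * N := by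
  obtain ⟨C, hC, h⟩ := sum_inv_lcm_le m hm
  refine ⟨C, hC, fun M N => ?_⟩
  have hpow : ∀ n, #{d ∈ Ioc 0 N | d ∣ n} ^ m =
      ∑ t ∈ Fintype.piFinset (fun _ : Fin m => Ioc 0 N), if univ.lcm t ∣ n then 1 else 0 := by
    intro n
    rw [← card_filter]
    calc _ = #(Fintype.piFinset fun _ : Fin m => {d ∈ Ioc 0 N | d ∣ n}) := by simp
      _ = _ := by
        congr 1
        ext t
        simp only [Fintype.mem_piFinset, mem_filter, Finset.lcm_dvd_iff, mem_univ, true_implies,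
          forall_and]
  have hswap : ∑ n ∈ Ioc 0 M, #{d ∈ Ioc 0 N | d ∣ n} ^ m =
      ∑ t ∈ Fintype.piFinset (fun _ : Fin m => Ioc 0 N), M / univ.lcm t := by
    simp_rw [hpow]
    rw [sum_comm]
    refine sum_congr rfl fun t _ => ?_
    rw [← card_filter, Nat.Ioc_filter_dvd_card_eq_div]
  calc ∑ n ∈ Ioc 0 M, (#{d ∈ Ioc 0 N | d ∣ n} : ℝ) ^ m
      = ∑ t ∈ Fintype.piFinset (fun _ : Fin m => Ioc 0 N), ((M / univ.lcm t : ℕ) : ℝ) := by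
        exact_mod_cast hswap
    _ ≤ ∑ t ∈ Fintype.piFinset (fun _ : Fin m => Ioc 0 N), M * ((1 : ℝ) / (univ.lcm t : ℕ)) := by
        gcongr with t _
        rw [mul_one_div]
        exact Nat.cast_div_le
    _ ≤ M * (C * N) := by
        rw [← mul_sum]
        gcongr
        exact h N
    _ = C * M * N := by ring

theorem sum_card_filter_dvd_pow_succ_le (j : ℕ) (hj : 1 ≤ j) {η : ℝ} (hη : 0 < η) :
    ∃ C : ℝ, 0 < C ∧ ∀ (X : ℝ) (B : Finset ℕ), 1 ≤ X → (∀ n ∈ B, 0 < n ∧ (n : ℝ) ≤ 2 * X) →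
      ∀ Δ : ℝ, 1 ≤ Δ →
        ∑ d ∈ Icc ⌈Δ⌉₊ ⌊2 * Δ⌋₊, (#{n ∈ B | d ∣ n} : ℝ) ^ (j + 1) ≤
          C * Δ ^ (-(j : ℝ) + 2 * η) * X ^ j * #B := by
  obtain ⟨r, hr⟩ := exists_nat_ge (3 / (2 * η))
  rw [div_le_iff₀ (by positivity)] at hr
  obtain ⟨C, hC, hmoment⟩ := sum_card_filter_dvd_pow_le (r + 1) (by omega)
  refine ⟨2 + 2 ^ j * (4 * C + 1), by positivity, fun X B hX hB Δ hΔ => ?_⟩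
  have hΔ0 : 0 < Δ := by linarith
  have hX0 : 0 < X := by linarith
  set N := ⌊2 * Δ⌋₊ with hN
  have hNle : (N : ℝ) ≤ 2 * Δ := Nat.floor_le (by positivity)
  have hMle : (⌊2 * X⌋₊ : ℝ) ≤ 2 * X := Nat.floor_le (by positivity)
  have hsub : Icc ⌈Δ⌉₊ N ⊆ Ioc 0 N := fun d hd => by
    have := (mem_Icc.mp hd)
    exact mem_Ioc.mpr ⟨(Nat.ceil_pos.mpr hΔ0).trans_le this.1, this.2⟩
  have hBsub : B ⊆ Ioc 0 ⌊2 * X⌋₊ := fun n hn =>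
    mem_Ioc.mpr ⟨(hB n hn).1, Nat.le_floor (hB n hn).2⟩
  have hη1 : 1 ≤ Δ ^ (2 * η) := Real.one_le_rpow hΔ (by positivity)
  have hsplit : Δ ^ (-(j : ℝ) + 2 * η) = (Δ ^ j)⁻¹ * Δ ^ (2 * η) := by
    rw [Real.rpow_add hΔ0, Real.rpow_neg hΔ0.le, Real.rpow_natCast]
  rw [hsplit]
  rcases le_or_gt (#B * Δ ^ 2) X with hcase | hcase
  · have hBle : (#B : ℝ) ≤ X / Δ ^ 2 := (le_div_iff₀ (by positivity)).mpr hcase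
    calc ∑ d ∈ Icc ⌈Δ⌉₊ N, (#{n ∈ B | d ∣ n} : ℝ) ^ (j + 1)
        ≤ ∑ d ∈ Ioc 0 N, (#{n ∈ B | d ∣ n} : ℝ) ^ (j + 1) :=
          sum_le_sum_of_subset_of_nonneg hsub fun _ _ _ => by positivity
      _ ≤ ∑ _d ∈ Ioc 0 N, (#B : ℝ) ^ (j + 1) := by
          gcongr
          exact filter_subset _ _
      _ = N * ((#B : ℝ) ^ j * #B) := by simp [pow_succ]
      _ ≤ (2 * Δ ^ j) * ((X / Δ ^ 2) ^ j * #B) := by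
          gcongr
          exact hNle.trans (by gcongr; exact le_self_pow₀ hΔ (by omega))
      _ = 2 * ((Δ ^ j)⁻¹ * 1) * X ^ j * #B := by
          rw [div_pow, ← pow_mul, mul_comm 2 j, pow_mul]
          field_simp
      _ ≤ (2 + 2 ^ j * (4 * C + 1)) * ((Δ ^ j)⁻¹ * Δ ^ (2 * η)) * X ^ j * #B := by
          gcongr
          linarith [show 0 ≤ 2 ^ j * (4 * C + 1) by positivity]
  · have hterm : ∀ d ∈ Icc ⌈Δ⌉₊ N, (#{n ∈ B | d ∣ n} : ℝ) ≤ 2 * X / Δ := by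
      intro d hd
      have hd : Δ ≤ d := Nat.ceil_le.mp (mem_Icc.mp hd).1
      calc (#{n ∈ B | d ∣ n} : ℝ) ≤ #{n ∈ Ioc 0 ⌊2 * X⌋₊ | d ∣ n} := by gcongr
        _ = (⌊2 * X⌋₊ / d : ℕ) := by rw [Nat.Ioc_filter_dvd_card_eq_div]
        _ ≤ (⌊2 * X⌋₊ : ℝ) / d := Nat.cast_div_le
        _ ≤ 2 * X / Δ := by gcongr
    have hswap : ∑ d ∈ Ioc 0 N, (#{n ∈ B | d ∣ n} : ℝ) =
        ∑ n ∈ B, (#{d ∈ Ioc 0 N | d ∣ n} : ℝ) := by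
      exact_mod_cast sum_card_bipartiteAbove_eq_sum_card_bipartiteBelow (fun d n : ℕ => d ∣ n)
    have hfirst : ∑ n ∈ B, (#{d ∈ Ioc 0 N | d ∣ n} : ℝ) ≤ #B * ((4 * C + 1) * Δ ^ (2 * η)) := by
      refine le_of_pow_le_pow_left₀ (n := r + 1) (by omega) (by positivity) ?_
      have hΔ3 : Δ ^ 3 ≤ (Δ ^ (2 * η)) ^ (r + 1) := by
        rw [← Real.rpow_natCast, ← Real.rpow_natCast, ← Real.rpow_mul hΔ0.le]
        refine Real.rpow_le_rpow_of_exponent_le hΔ ?_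
        push_cast
        linarith
      calc (∑ n ∈ B, (#{d ∈ Ioc 0 N | d ∣ n} : ℝ)) ^ (r + 1)
          ≤ (#B : ℝ) ^ r * ∑ n ∈ B, (#{d ∈ Ioc 0 N | d ∣ n} : ℝ) ^ (r + 1) :=
            pow_sum_le_card_mul_sum_pow (fun _ _ => by positivity) r
        _ ≤ (#B : ℝ) ^ r * ∑ n ∈ Ioc 0 ⌊2 * X⌋₊, (#{d ∈ Ioc 0 N | d ∣ n} : ℝ) ^ (r + 1) := by
            gcongr
        _ ≤ (#B : ℝ) ^ r * (C * (2 * (#B * Δ ^ 2)) * (2 * Δ)) := by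
            refine mul_le_mul_of_nonneg_left ((hmoment _ _).trans ?_) (by positivity)
            gcongr
            linarith
        _ = (#B : ℝ) ^ (r + 1) * (4 * C * Δ ^ 3) := by ring
        _ ≤ (#B : ℝ) ^ (r + 1) * ((4 * C + 1) ^ (r + 1) * (Δ ^ (2 * η)) ^ (r + 1)) := by
            gcongr
            exact (le_add_of_nonneg_right zero_le_one).trans
              (le_self_pow₀ (by linarith) (by omega))
        _ = _ := by rw [mul_pow, mul_pow]
    calc ∑ d ∈ Icc ⌈Δ⌉₊ N, (#{n ∈ B | d ∣ n} : ℝ) ^ (j + 1)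
        ≤ ∑ d ∈ Icc ⌈Δ⌉₊ N, (2 * X / Δ) ^ j * (#{n ∈ B | d ∣ n} : ℝ) := by
          refine sum_le_sum fun d hd => ?_
          rw [pow_succ]
          gcongr
          exact hterm d hd
      _ = (2 * X / Δ) ^ j * ∑ d ∈ Icc ⌈Δ⌉₊ N, (#{n ∈ B | d ∣ n} : ℝ) := by rw [mul_sum]
      _ ≤ (2 * X / Δ) ^ j * ∑ d ∈ Ioc 0 N, (#{n ∈ B | d ∣ n} : ℝ) := by gcongr
      _ ≤ (2 * X / Δ) ^ j * (#B * ((4 * C + 1) * Δ ^ (2 * η))) := by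
          rw [hswap]
          gcongr
      _ = (2 ^ j * (4 * C + 1)) * ((Δ ^ j)⁻¹ * Δ ^ (2 * η)) * X ^ j * #B := by
          rw [div_pow, mul_pow]
          ring
      _ ≤ _ := by
          gcongr
          linarith

theorem sum_prod_le_prod_rpow_of_sum_pow_le {ι κ : Type*} [Fintype ι] [Nonempty ι]
    (s : Finset κ) (f : ι → κ → ℝ) (T : ι → ℝ) (hf : ∀ i, ∀ d ∈ s, 0 ≤ f i d)
    (hT : ∀ i, ∑ d ∈ s, f i d ^ Fintype.card ι ≤ T i) :
    ∑ d ∈ s, ∏ i, f i d ≤ ∏ i, T i ^ (1 / (Fintype.card ι : ℝ)) := by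
  set k := Fintype.card ι with hk
  have hk0 : k ≠ 0 := Fintype.card_ne_zero
  have hkpos : (0 : ℝ) < k := by positivity
  have hT0 : ∀ i, 0 ≤ T i := fun i =>
    (sum_nonneg fun d hd => pow_nonneg (hf i d hd) _).trans (hT i)
  by_cases hz : ∃ i, T i = 0
  · obtain ⟨i, hi⟩ := hz
    have hzero : ∀ d ∈ s, f i d = 0 := by
      have h0 : ∑ d ∈ s, f i d ^ k = 0 :=
        le_antisymm (hi ▸ hT i) (sum_nonneg fun d hd => pow_nonneg (hf i d hd) _)
      intro d hd
      exact pow_eq_zero_iff hk0 |>.mp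
        ((sum_eq_zero_iff_of_nonneg fun d hd => pow_nonneg (hf i d hd) _).mp h0 d hd)
    rw [sum_eq_zero fun d hd => prod_eq_zero (mem_univ i) (hzero d hd)]
    exact prod_nonneg fun i _ => Real.rpow_nonneg (hT0 i) _
  · push Not at hz
    have hTpos : ∀ i, 0 < T i := fun i => lt_of_le_of_ne (hT0 i) (hz i).symm
    set P := ∏ i, T i ^ (1 / (k : ℝ)) with hP
    have hP0 : 0 < P := prod_pos fun i _ => Real.rpow_pos_of_pos (hTpos i) _
    have hamgm : ∀ d ∈ s, ∏ i, f i d ≤ P * ∑ i, 1 / (k : ℝ) * (f i d ^ k / T i) := by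
      intro d hd
      have h := Real.geom_mean_le_arith_mean_weighted univ (fun _ : ι => 1 / (k : ℝ))
        (fun i => f i d ^ k / T i) (fun _ _ => by positivity) (by simp [← hk, hk0])
        (fun i _ => div_nonneg (pow_nonneg (hf i d hd) _) (hT0 i))
      have heq : ∏ i, f i d = P * ∏ i, (f i d ^ k / T i) ^ (1 / (k : ℝ)) := by
        rw [hP, ← prod_mul_distrib]
        refine prod_congr rfl fun i _ => ?_
        rw [← Real.mul_rpow (hT0 i) (div_nonneg (pow_nonneg (hf i d hd) _) (hT0 i)),
          mul_div_cancel₀ _ (hz i), one_div, Real.pow_rpow_inv_natCast (hf i d hd) hk0]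
      rw [heq]
      gcongr
    calc ∑ d ∈ s, ∏ i, f i d ≤ ∑ d ∈ s, P * ∑ i, 1 / (k : ℝ) * (f i d ^ k / T i) :=
          sum_le_sum hamgm
      _ = P * ∑ i, 1 / (k : ℝ) * ((∑ d ∈ s, f i d ^ k) / T i) := by
          rw [← mul_sum, sum_comm]
          simp_rw [← mul_sum, ← sum_div]
      _ ≤ P * ∑ _i : ι, 1 / (k : ℝ) * 1 := by
          gcongr with i _
          exact div_le_one_of_le₀ (hT i) (hT0 i)
      _ = P := by simp [← hk, hk0]

theorem dyadic_block_estimate (k : ℕ) (hk : 2 ≤ k) (η : ℝ) (hη : 0 < η) :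
    ∃ C : ℝ, 0 < C ∧
      ∀ (X : Fin k → ℝ) (A : Fin k → Finset ℤ),
        (∀ i, 1 ≤ X i) →
        (∀ i, ∀ a ∈ A i, X i ≤ (a : ℝ) ∧ (a : ℝ) ≤ 2 * X i) →
        ∀ Δ : ℝ, 1 ≤ Δ → (∀ i, Δ ≤ 2 * X i) →
        ∑ d ∈ Finset.Icc ⌈Δ⌉₊ ⌊2 * Δ⌋₊,
            ∏ i, (((A i).filter (fun n => (d : ℤ) ∣ n)).card : ℝ) ≤
          C * Δ ^ (-((k : ℝ) - 1) + 2 * η) *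
            (∏ i, X i ^ (((k : ℝ) - 1) / (k : ℝ))) *
            (∏ i, ((A i).card : ℝ) ^ ((1 : ℝ) / (k : ℝ))) := by
  obtain ⟨j, rfl⟩ : ∃ j, k = j + 1 := ⟨k - 1, by omega⟩
  obtain ⟨C, hC, hsingle⟩ := sum_card_filter_dvd_pow_succ_le j (by omega) hη
  refine ⟨C, hC, fun X A hX hA Δ hΔ _ => ?_⟩
  have hX0 : ∀ i, 0 ≤ X i := fun i => zero_le_one.trans (hX i)
  have hcast : ((j + 1 : ℕ) : ℝ) - 1 = j := by push_cast; ring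
  rw [hcast]
  have hpos : ∀ i, ∀ a ∈ A i, 0 < a := fun i a ha => by
    have : (0 : ℝ) < a := zero_lt_one.trans_le ((hX i).trans (hA i a ha).1)
    exact_mod_cast this
  have hinj : ∀ i, Set.InjOn Int.toNat (A i : Set ℤ) := fun i a ha b hb hab => by
    have h1 := hpos i a ha
    have h2 := hpos i b hb
    omega
  have hcard : ∀ i, #((A i).image Int.toNat) = #(A i) := fun i => card_image_of_injOn (hinj i)
  have hfilter : ∀ i (d : ℕ),
      #{n ∈ (A i).image Int.toNat | d ∣ n} = #{n ∈ A i | (d : ℤ) ∣ n} := fun i d => by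
    rw [filter_image, card_image_of_injOn ((hinj i).mono (coe_subset.mpr (filter_subset _ _)))]
    congr 1
    refine filter_congr fun a ha => ?_
    rw [← Int.natCast_dvd_natCast, Int.toNat_of_nonneg (hpos i a ha).le]
  have hT : ∀ i, ∑ d ∈ Icc ⌈Δ⌉₊ ⌊2 * Δ⌋₊,
      (#{n ∈ A i | (d : ℤ) ∣ n} : ℝ) ^ Fintype.card (Fin (j + 1)) ≤
        C * Δ ^ (-(j : ℝ) + 2 * η) * X i ^ j * #(A i) := by
    intro i
    have h := hsingle (X i) ((A i).image Int.toNat) (hX i) (by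
      intro n hn
      obtain ⟨a, ha, rfl⟩ := mem_image.mp hn
      have hap := hpos i a ha
      refine ⟨by omega, ?_⟩
      have hcasta : ((a.toNat : ℕ) : ℝ) = (a : ℝ) := by
        exact_mod_cast congrArg (Int.cast : ℤ → ℝ) (Int.toNat_of_nonneg hap.le)
      rw [hcasta]
      exact (hA i a ha).2) Δ hΔ
    simp_rw [hfilter, hcard] at h
    simpa using h
  refine (sum_prod_le_prod_rpow_of_sum_pow_le _ _ _ (fun _ _ _ => by positivity) hT).trans_eq ?_
  have hE : 0 ≤ C * Δ ^ (-(j : ℝ) + 2 * η) := by positivity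
  rw [Fintype.card_fin]
  have hfactor : ∀ i, (C * Δ ^ (-(j : ℝ) + 2 * η) * X i ^ j * #(A i)) ^ (1 / ((j + 1 : ℕ) : ℝ)) =
      (C * Δ ^ (-(j : ℝ) + 2 * η)) ^ (1 / ((j + 1 : ℕ) : ℝ)) *
        X i ^ ((j : ℝ) / ((j + 1 : ℕ) : ℝ)) * (#(A i) : ℝ) ^ (1 / ((j + 1 : ℕ) : ℝ)) := by
    intro i
    have hXj : 0 ≤ X i ^ j := pow_nonneg (hX0 i) j
    rw [Real.mul_rpow (mul_nonneg hE hXj) (by positivity), Real.mul_rpow hE hXj,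
      ← Real.rpow_natCast (X i), ← Real.rpow_mul (hX0 i), mul_one_div]
  simp_rw [hfactor]
  rw [prod_mul_distrib, prod_mul_distrib, prod_const, card_univ, Fintype.card_fin, one_div,
    Real.rpow_inv_natCast_pow hE (by omega)]
end

section
/- Let k ≥ 2 be an integer. There is a constant C(k) > 0 such that the following holds. Let X_1, …, X_k, L ∈ [2, ∞) with L ≥ max(X_1, …, X_k), let δ ∈ (0,1], and let A_1, …, A_k be finite sets of positive integers with A_i ⊆ [X_i, 2X_i], such that the number of tuples (a_1, …, a_k) ∈ A_1 × ⋯ × A_k with lcm(a_1, …, a_k) ≤ L is at least δ·∏_{i=1}^k |A_i|. Then ∏_{i=1}^k |A_i| ≤ C(k) · δ^{-1} · L · (log L)^{2^k − 1}. -/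
open Finset

theorem Finset.exists_dvd_and_eq_prod_of_dvd_prod {ι : Type*} [DecidableEq ι] (s : Finset ι)
    (d : ι → ℕ) (g : ℕ) (hg : g ∣ ∏ i ∈ s, d i) :
    ∃ e : ι → ℕ, (∀ i ∈ s, e i ∣ d i) ∧ ∏ i ∈ s, e i = g := by
  induction s using Finset.induction_on generalizing g with
  | empty => exact ⟨fun _ => 1, by simp, by simpa [eq_comm] using hg⟩
  | insert j s hj ih =>
    rw [prod_insert hj] at hg
    obtain ⟨x, y, hx, hy, rfl⟩ := exists_dvd_and_dvd_of_dvd_mul hg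
    obtain ⟨e, he, rfl⟩ := ih y hy
    refine ⟨Function.update e j x, fun i hi => ?_, ?_⟩
    · rcases eq_or_ne i j with rfl | hij
      · simpa using hx
      · simpa [hij] using he i (mem_of_mem_insert_of_ne hi hij)
    · rw [prod_insert hj, Function.update_self]
      congr 1
      exact prod_congr rfl fun i hi =>
        Function.update_of_ne (ne_of_mem_of_not_mem hi hj) _ _

/-- Positive integers `a i` factor simultaneously as `a i = ∏_{S ∋ i} d S` in such a way that
their least common multiple is `∏_S d S`. -/
theorem exists_lcm_eq_prod_powerset {ι : Type*} [DecidableEq ι] (s : Finset ι) (a : ι → ℕ)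
    (ha : ∀ i ∈ s, 0 < a i) :
    ∃ d : Finset ι → ℕ, d ∅ = 1 ∧ s.lcm a = ∏ S ∈ s.powerset, d S ∧
      ∀ i ∈ s, a i = ∏ S ∈ s.powerset, if i ∈ S then d S else 1 := by
  induction s using Finset.induction_on with
  | empty => exact ⟨fun _ => 1, by simp⟩
  | insert i s hi ih =>
    obtain ⟨d, hd, hlcm, hfac⟩ := ih fun j hj => ha j (mem_insert_of_mem hj)
    obtain ⟨g, hgd, hg⟩ := exists_dvd_and_eq_prod_of_dvd_prod s.powerset d
      (Nat.gcd (a i) (s.lcm a)) (hlcm ▸ Nat.gcd_dvd_right _ _)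
    set q := a i / Nat.gcd (a i) (s.lcm a)
    have hqa : Nat.gcd (a i) (s.lcm a) * q = a i := Nat.mul_div_cancel' (Nat.gcd_dvd_left _ _)
    let c : Finset ι → ℕ := fun S => g S * if S = ∅ then q else 1
    have hc : ∏ S ∈ s.powerset, c S = a i := by
      simp only [c, prod_mul_distrib, hg, prod_ite_eq', empty_mem_powerset, if_true, hqa]
    have hnot : ∀ S ∈ s.powerset, i ∉ S := fun S hS h => hi (mem_powerset.1 hS h)
    have hdg : ∀ S ∈ s.powerset, d S / g S * g S = d S := fun S hS =>
      Nat.div_mul_cancel (hgd S hS)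
    refine ⟨fun T => if i ∈ T then c (T.erase i) else d T / g T, ?_, ?_, ?_⟩
    · have h := hgd ∅ (empty_mem_powerset s)
      rw [hd, Nat.dvd_one] at h
      simp [h, hd]
    · rw [lcm_insert, prod_powerset_insert hi, ← prod_mul_distrib,
        prod_congr (g := fun S => d S * if S = ∅ then q else 1) rfl fun S hS => by
          simp only [hnot S hS, if_false, mem_insert_self, if_true, erase_insert (hnot S hS), c]
          rw [← mul_assoc, hdg S hS],
        prod_mul_distrib, ← hlcm, prod_ite_eq', if_pos (empty_mem_powerset s)]
      change Nat.lcm (a i) (s.lcm a) = _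
      rw [Nat.lcm, mul_comm (a i), Nat.mul_div_assoc _ (Nat.gcd_dvd_left _ _)]
    · intro j hj
      rw [prod_powerset_insert hi, ← prod_mul_distrib]
      rcases eq_or_ne j i with rfl | hji
      · rw [← hc]
        refine prod_congr rfl fun S hS => ?_
        simp [hnot S hS]
      · rw [hfac j (mem_of_mem_insert_of_ne hj hji)]
        refine prod_congr rfl fun S hS => ?_
        by_cases hjS : j ∈ S
        · have hS0 : S ≠ ∅ := ne_empty_of_mem hjS
          simp [hnot S hS, hjS, c, hS0, hdg S hS]
        · simp [hjS, hji]

theorem card_filter_lcm_le {k : ℕ} (A : Fin k → Finset ℕ) (hA : ∀ i, ∀ a ∈ A i, 0 < a)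
    (N : ℕ) :
    (((Fintype.piFinset A).filter fun a => (univ.lcm a : ℕ) ≤ N).card : ℝ) ≤
      N * (∑ n ∈ Icc 1 N, (n : ℝ)⁻¹) ^ (2 ^ k - 1) := by
  classical
  let t : Finset (Fin k) → Finset ℕ := fun S => if S = ∅ then {1} else Icc 1 N
  let D := (Fintype.piFinset t).filter fun d => ∏ S, d S ≤ N
  have ht : ∀ d ∈ Fintype.piFinset t, ∀ S, 0 < d S := by
    intro d hd S
    have h := Fintype.mem_piFinset.1 hd S
    by_cases hS : S = ∅
    · simp only [t, hS, if_true, mem_singleton] at h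
      simp [hS, h]
    · simp only [t, hS, if_false, mem_Icc] at h
      exact h.1
  have hcard : ((Fintype.piFinset A).filter fun a => (univ.lcm a : ℕ) ≤ N).card ≤ D.card := by
    refine (card_le_card ?_).trans
      (card_image_le (s := D) (f := fun d i => ∏ S, if i ∈ S then d S else 1))
    intro a ha
    rw [mem_filter, Fintype.mem_piFinset] at ha
    have hpos : ∀ i ∈ univ, 0 < a i := fun i _ => hA i _ (ha.1 i)
    obtain ⟨d, hd, hlcm, hfac⟩ := exists_lcm_eq_prod_powerset univ a hpos
    rw [powerset_univ] at hlcm hfac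
    have hprod : 0 < ∏ S, d S := by
      rw [← hlcm, Nat.pos_iff_ne_zero, Ne, Finset.lcm_eq_zero_iff]
      rintro ⟨i, hi, h⟩
      exact (hpos i hi).ne' h
    refine mem_image.2 ⟨d, mem_filter.2 ⟨Fintype.mem_piFinset.2 fun S => ?_, hlcm ▸ ha.2⟩,
      funext fun i => (hfac i (mem_univ i)).symm⟩
    have hdvd : d S ∣ ∏ S, d S := dvd_prod_of_mem d (mem_univ S)
    by_cases hS : S = ∅
    · simp [t, hS, hd]
    · simp only [t, hS, if_false, mem_Icc]
      exact ⟨Nat.pos_of_dvd_of_pos hdvd hprod,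
        (Nat.le_of_dvd hprod hdvd).trans (hlcm ▸ ha.2)⟩
  calc (((Fintype.piFinset A).filter fun a => (univ.lcm a : ℕ) ≤ N).card : ℝ)
      ≤ D.card := by exact_mod_cast hcard
    _ = ∑ d ∈ D, (1 : ℝ) := by simp
    _ ≤ ∑ d ∈ D, (N : ℝ) * ∏ S, (d S : ℝ)⁻¹ := by
        refine sum_le_sum fun d hd => ?_
        obtain ⟨hd, hN⟩ := mem_filter.1 hd
        have h : (0 : ℝ) < ∏ S, (d S : ℝ) :=
          prod_pos fun S _ => Nat.cast_pos.2 (ht d hd S)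
        rw [prod_inv_distrib, ← div_eq_mul_inv, one_le_div h]
        exact_mod_cast hN
    _ ≤ ∑ d ∈ Fintype.piFinset t, (N : ℝ) * ∏ S, (d S : ℝ)⁻¹ :=
        sum_le_sum_of_subset_of_nonneg (filter_subset _ _) fun _ _ _ => by positivity
    _ = N * (∑ n ∈ Icc 1 N, (n : ℝ)⁻¹) ^ (2 ^ k - 1) := by
        rw [← mul_sum, ← prod_univ_sum t fun _ n => (n : ℝ)⁻¹,
          ← mul_prod_erase univ _ (mem_univ ∅),
          prod_congr (g := fun _ => ∑ n ∈ Icc 1 N, (n : ℝ)⁻¹) rfl fun S hS => by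
            simp only [t, if_neg (ne_of_mem_erase hS)]]
        simp [t, card_erase_of_mem]

theorem sum_Icc_inv_le_three_mul_log {L : ℝ} (hL : 2 ≤ L) :
    ∑ n ∈ Icc 1 ⌊L⌋₊, (n : ℝ)⁻¹ ≤ 3 * Real.log L := by
  have h := harmonic_floor_le_one_add_log L (by linarith)
  rw [harmonic_eq_sum_Icc] at h
  push_cast at h
  have hlog : Real.log 2 ≤ Real.log L := Real.log_le_log (by norm_num) hL
  linarith [Real.log_two_gt_d9]

theorem lcm_trivial_bound (k : ℕ) (hk : 2 ≤ k) :
    ∃ C : ℝ, 0 < C ∧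
      ∀ (X : Fin k → ℝ) (L δ : ℝ) (A : Fin k → Finset ℕ),
        (∀ i, 2 ≤ X i) → 2 ≤ L → (∀ i, X i ≤ L) → δ ∈ Set.Ioc (0:ℝ) 1 →
        (∀ i, ∀ a ∈ A i, 0 < a) →
        (∀ i, ∀ a ∈ A i, X i ≤ (a : ℝ) ∧ (a : ℝ) ≤ 2 * X i) →
        δ * ∏ i, ((A i).card : ℝ) ≤
          (((Fintype.piFinset A).filter
            (fun a => ((Finset.univ.lcm a : ℕ) : ℝ) ≤ L)).card : ℝ) →
        ∏ i, ((A i).card : ℝ) ≤ C * δ⁻¹ * L * Real.log L ^ (2 ^ k - 1) := by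
  refine ⟨3 ^ (2 ^ k - 1), by positivity, ?_⟩
  intro X L δ A _ hL _ hδ hA _ h
  have hL0 : 0 ≤ L := by linarith
  have hcard := card_filter_lcm_le A hA ⌊L⌋₊
  simp only [Nat.le_floor_iff hL0] at hcard
  have hbound : δ * ∏ i, ((A i).card : ℝ) ≤ L * (3 * Real.log L) ^ (2 ^ k - 1) := by
    refine (h.trans hcard).trans ?_
    gcongr
    · exact Nat.floor_le hL0
    · exact sum_Icc_inv_le_three_mul_log hL
  calc ∏ i, ((A i).card : ℝ) = δ⁻¹ * (δ * ∏ i, ((A i).card : ℝ)) := by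
        rw [inv_mul_cancel_left₀ hδ.1.ne']
    _ ≤ δ⁻¹ * (L * (3 * Real.log L) ^ (2 ^ k - 1)) :=
        mul_le_mul_of_nonneg_left hbound (inv_nonneg.2 hδ.1.le)
    _ = 3 ^ (2 ^ k - 1) * δ⁻¹ * L * Real.log L ^ (2 ^ k - 1) := by
        rw [mul_pow]; ring
end

section
/- Let k ≥ 2 be an integer. There is a constant C(k) > 0 such that the following holds. Let X_1, …, X_k, D ∈ [1, ∞) with D ≤ min(X_1, …, X_k), let δ ∈ (0,1], and let A_1, …, A_k be finite sets of positive integers with A_i ⊆ [X_i, 2X_i], such that the number of tuples (a_1, …, a_k) ∈ A_1 × ⋯ × A_k with gcd(a_1, …, a_k) ≥ D is at least δ·∏_{i=1}^k |A_i|. Then ∏_{i=1}^k |A_i| ≤ C(k) · δ^{-1} · (∏_{i=1}^k X_i) / D^{k-1}. -/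
open Finset

/-- The number of tuples in a box of positive integers all of whose entries are divisible by `d`
is at most the volume of the box divided by `d ^ k`. -/
lemma card_piFinset_filter_dvd_le {k : ℕ} (Y : Fin k → ℝ) (hY : ∀ i, 0 ≤ Y i) (d : ℕ) :
    ((Fintype.piFinset fun i => (Ioc 0 ⌊Y i⌋₊).filter (d ∣ ·)).card : ℝ) ≤
      (∏ i, Y i) / (d : ℝ) ^ k := by
  have hprod : (∏ i, Y i) / (d : ℝ) ^ k = ∏ i, Y i / (d : ℝ) := by
    rw [Finset.prod_div_distrib, Finset.prod_const, Finset.card_univ, Fintype.card_fin]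
  rw [hprod, Fintype.card_piFinset, Nat.cast_prod]
  refine Finset.prod_le_prod (fun _ _ => Nat.cast_nonneg _) fun i _ => ?_
  rw [Nat.Ioc_filter_dvd_card_eq_div]
  refine Nat.cast_div_le.trans ?_
  gcongr
  exact Nat.floor_le (hY i)

/-- The tail of `∑ d ^ (-k)` from `D` on is at most `2 / D ^ (k - 1)`. -/
lemma sum_Ioo_inv_pow_le {k : ℕ} (hk : 2 ≤ k) {D : ℝ} (hD : 1 ≤ D) (N : ℕ) :
    ∑ d ∈ Ioo (⌈D⌉₊ - 1) N, ((d : ℝ) ^ k)⁻¹ ≤ 2 / D ^ (k - 1) := by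
  have hD0 : 0 < D := by linarith
  have hceil : 0 < ⌈D⌉₊ := Nat.ceil_pos.2 hD0
  have hcast : D ≤ ((⌈D⌉₊ - 1 : ℕ) : ℝ) + 1 := by
    have h : ((⌈D⌉₊ - 1 : ℕ) : ℝ) + 1 = (⌈D⌉₊ : ℝ) := by
      exact_mod_cast Nat.sub_add_cancel hceil
    rw [h]
    exact Nat.le_ceil D
  obtain ⟨j, rfl⟩ := Nat.exists_eq_add_of_le' hk
  calc ∑ d ∈ Ioo (⌈D⌉₊ - 1) N, ((d : ℝ) ^ (j + 2))⁻¹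
      ≤ ∑ d ∈ Ioo (⌈D⌉₊ - 1) N, (D ^ j)⁻¹ * ((d : ℝ) ^ 2)⁻¹ := by
        refine Finset.sum_le_sum fun d hd => ?_
        have hd' : ⌈D⌉₊ ≤ d := by
          have := (Finset.mem_Ioo.1 hd).1
          omega
        have hDd : D ≤ d := Nat.ceil_le.1 hd'
        have hd0 : (0 : ℝ) < d := by linarith
        rw [pow_add, mul_inv]
        gcongr
    _ = (D ^ j)⁻¹ * ∑ d ∈ Ioo (⌈D⌉₊ - 1) N, ((d : ℝ) ^ 2)⁻¹ := by rw [Finset.mul_sum]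
    _ ≤ (D ^ j)⁻¹ * (2 / D) := by
        gcongr
        refine (sum_Ioo_inv_sq_le _ _).trans ?_
        gcongr
    _ = 2 / D ^ (j + 2 - 1) := by
        rw [show j + 2 - 1 = j + 1 by omega, pow_succ]
        field_simp

/-- The number of tuples of positive integers in a box with greatest common divisor at least `D`
is at most twice the volume of the box divided by `D ^ (k - 1)`. -/
lemma card_filter_le_gcd_le {k : ℕ} (hk : 2 ≤ k) (Y : Fin k → ℝ) (hY : ∀ i, 0 ≤ Y i)
    {D : ℝ} (hD : 1 ≤ D) (A : Fin k → Finset ℕ) (hpos : ∀ i, ∀ a ∈ A i, 0 < a)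
    (hA : ∀ i, ∀ a ∈ A i, (a : ℝ) ≤ Y i) :
    (((Fintype.piFinset A).filter
      (fun a => D ≤ ((Finset.univ.gcd a : ℕ) : ℝ))).card : ℝ) ≤
      (∏ i, Y i) * (2 / D ^ (k - 1)) := by
  set S := (Fintype.piFinset A).filter (fun a => D ≤ ((Finset.univ.gcd a : ℕ) : ℝ)) with hS
  let i₀ : Fin k := ⟨0, by omega⟩
  have hceil : 0 < ⌈D⌉₊ := Nat.ceil_pos.2 (by linarith)
  have hmaps : Set.MapsTo (fun a : Fin k → ℕ => Finset.univ.gcd a) (S : Set (Fin k → ℕ))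
      (Ioo (⌈D⌉₊ - 1) (⌊Y i₀⌋₊ + 1) : Finset ℕ) := by
    intro a ha
    rw [Finset.mem_coe, hS, Finset.mem_filter, Fintype.mem_piFinset] at ha
    rw [Finset.mem_coe, Finset.mem_Ioo]
    have hlow : ⌈D⌉₊ ≤ Finset.univ.gcd a := Nat.ceil_le.2 ha.2
    have hgcd : Finset.univ.gcd a ≤ a i₀ :=
      Nat.le_of_dvd (hpos _ _ (ha.1 i₀)) (Finset.gcd_dvd (Finset.mem_univ _))
    have hup : a i₀ ≤ ⌊Y i₀⌋₊ := Nat.le_floor (hA _ _ (ha.1 i₀))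
    constructor
    · change _ < Finset.univ.gcd a
      omega
    · change Finset.univ.gcd a < _
      omega
  rw [Finset.card_eq_sum_card_fiberwise hmaps, Nat.cast_sum]
  calc _ ≤ ∑ d ∈ Ioo (⌈D⌉₊ - 1) (⌊Y i₀⌋₊ + 1), (∏ i, Y i) * ((d : ℝ) ^ k)⁻¹ := by
        refine Finset.sum_le_sum fun d _ => ?_
        rw [← div_eq_mul_inv]
        refine le_trans ?_ (card_piFinset_filter_dvd_le Y hY d)
        refine Nat.cast_le.2 (Finset.card_le_card fun a ha => ?_)
        rw [Finset.mem_filter, hS, Finset.mem_filter, Fintype.mem_piFinset] at ha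
        rw [Fintype.mem_piFinset]
        intro i
        rw [Finset.mem_filter, Finset.mem_Ioc]
        refine ⟨⟨hpos _ _ (ha.1.1 i), Nat.le_floor (hA _ _ (ha.1.1 i))⟩, ?_⟩
        rw [← ha.2]
        exact Finset.gcd_dvd (Finset.mem_univ i)
    _ = (∏ i, Y i) * ∑ d ∈ Ioo (⌈D⌉₊ - 1) (⌊Y i₀⌋₊ + 1), ((d : ℝ) ^ k)⁻¹ := by
        rw [Finset.mul_sum]
    _ ≤ _ := mul_le_mul_of_nonneg_left (sum_Ioo_inv_pow_le hk hD _)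
        (Finset.prod_nonneg fun i _ => hY i)

theorem gcd_trivial_bound (k : ℕ) (hk : 2 ≤ k) :
    ∃ C : ℝ, 0 < C ∧
      ∀ (X : Fin k → ℝ) (D δ : ℝ) (A : Fin k → Finset ℕ),
        (∀ i, 1 ≤ X i) → 1 ≤ D → (∀ i, D ≤ X i) → δ ∈ Set.Ioc (0:ℝ) 1 →
        (∀ i, ∀ a ∈ A i, 0 < a) →
        (∀ i, ∀ a ∈ A i, X i ≤ (a : ℝ) ∧ (a : ℝ) ≤ 2 * X i) →
        δ * ∏ i, ((A i).card : ℝ) ≤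
          (((Fintype.piFinset A).filter
            (fun a => D ≤ ((Finset.univ.gcd a : ℕ) : ℝ))).card : ℝ) →
        ∏ i, ((A i).card : ℝ) ≤ C * δ⁻¹ * (∏ i, X i) / D ^ (k - 1) := by
  refine ⟨2 ^ k * 2, by positivity, ?_⟩
  intro X D δ A hX hD _ hδ hpos hA hcard
  have hcount := hcard.trans (card_filter_le_gcd_le hk (fun i => 2 * X i)
    (fun i => by linarith [hX i]) hD A hpos fun i a ha => (hA i a ha).2)
  rw [Finset.prod_mul_distrib, Finset.prod_const, Finset.card_univ, Fintype.card_fin] at hcount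
  calc ∏ i, ((A i).card : ℝ) = δ⁻¹ * (δ * ∏ i, ((A i).card : ℝ)) := by
        rw [inv_mul_cancel_left₀ hδ.1.ne']
    _ ≤ δ⁻¹ * (2 ^ k * (∏ i, X i) * (2 / D ^ (k - 1))) :=
        mul_le_mul_of_nonneg_left hcount (inv_nonneg.2 hδ.1.le)
    _ = 2 ^ k * 2 * δ⁻¹ * (∏ i, X i) / D ^ (k - 1) := by ring
end

section
/- Let k ≥ 2 be an integer. There exist constants c_k, C_k, K_k > 0 depending only on k such that the following holds. Let δ ∈ (0,1], let X_1, …, X_k, L ∈ [1,∞), and set M = ⌈c_k · δ^{-1/(k-1)}⌉ and Q = C_k · ((∏_{i=1}^k X_i)/L)^{1/(k-1)}. Assume K_k · M·log(2M) ≤ Q and K_k · Q ≤ min(X_1, …, X_k). Then there exist finite sets A_1, …, A_k of integers with A_i ⊆ [X_i, 2X_i] such that the number of tuples (a_1, …, a_k) ∈ A_1 × ⋯ × A_k with lcm(a_1, …, a_k) ≤ L is at least δ·∏_{i=1}^k |A_i|, and ∏_{i=1}^k |A_i| ≥ (1/K_k) · δ^{-k/(k-1)} · L^{k/(k-1)}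 / (∏_{i=1}^k X_i)^{1/(k-1)}. -/
open Finset

/-- Chebyshev: there are at least `M` primes in `(Q, 4Q]` once `Q ≫ M log (2M)`. -/
lemma exists_primes_card_eq : ∃ K : ℝ, 0 < K ∧ ∀ (M : ℕ) (Q : ℝ), 1 ≤ M →
    K * (M : ℝ) * Real.log (2 * (M : ℝ)) ≤ Q →
    ∃ S : Finset ℕ, S.card = M ∧ ∀ p ∈ S, p.Prime ∧ Q < p ∧ (p : ℝ) ≤ 4 * Q := by
  have hθ : ∀ᶠ x : ℝ in Filter.atTop, x / 2 ≤ Chebyshev.theta x := by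
    obtain ⟨C, hC⟩ := Chebyshev.psi_sub_theta_le_mul_sqrt
    have hlog : ∀ᶠ x : ℝ in Filter.atTop, Real.log x ≤ 0.01 * x := by
      have := Real.isLittleO_log_id_atTop.bound (c := 0.01) (by norm_num)
      filter_upwards [this, Filter.eventually_ge_atTop 1] with x hx h1
      simp only [Real.norm_eq_abs, id] at hx
      rw [abs_of_nonneg (by linarith : (0:ℝ) ≤ x)] at hx
      exact (le_abs_self _).trans hx
    filter_upwards [hlog, Filter.eventually_ge_atTop 100,
      Filter.eventually_ge_atTop ((100 * C) ^ 2)] with x hx h100 hxC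
    have h1 := Chebyshev.psi_ge' (x := x) (by linarith)
    have h2 := hC x
    have hs : C * √x ≤ 0.01 * x := by
      have h3 : 100 * C ≤ √x := Real.le_sqrt_of_sq_le hxC
      nlinarith [Real.sqrt_nonneg x, Real.sq_sqrt (show 0 ≤ x by linarith)]
    have h4 : Real.log (x + 2) ≤ Real.log 2 + Real.log x := by
      rw [← Real.log_mul (by norm_num) (by linarith)]
      exact Real.log_le_log (by linarith) (by linarith)
    nlinarith [Real.log_two_gt_d9, Real.log_two_lt_d9]
  obtain ⟨x₀, hx₀⟩ := Filter.eventually_atTop.1 hθ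
  refine ⟨2 * max x₀ 100, by positivity, fun M Q hM hQ => ?_⟩
  set B := max x₀ 100
  have hB100 : (100:ℝ) ≤ B := le_max_right _ _
  have hM' : (1:ℝ) ≤ M := by exact_mod_cast hM
  have hl2 := Real.log_two_gt_d9
  have hlM : Real.log 2 ≤ Real.log (2 * M) := Real.log_le_log (by norm_num) (by linarith)
  have hQB : B ≤ Q := by
    have : 1 * 0.5 ≤ (M:ℝ) * Real.log (2 * M) := by
      apply mul_le_mul hM' (by linarith) (by norm_num) (by linarith)
    nlinarith
  have hQ0 : 0 < Q := by linarith
  have hlower := hx₀ (4 * Q) (by linarith [le_max_left x₀ 100])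
  have hupper := Chebyshev.theta_le_log4_mul_x hQ0.le
  have hlog4 : Real.log 4 ≤ 1.4 := by
    rw [show (4:ℝ) = 2 ^ 2 by norm_num, Real.log_pow]
    push_cast; linarith [Real.log_two_lt_d9]
  set P := {p ∈ Ioc ⌊Q⌋₊ ⌊4 * Q⌋₊ | p.Prime}
  have hmem : ∀ p ∈ P, p.Prime ∧ Q < p ∧ (p : ℝ) ≤ 4 * Q := by
    intro p hp
    simp only [P, mem_filter, mem_Ioc] at hp
    exact ⟨hp.2, (Nat.floor_lt hQ0.le).1 hp.1.1, (Nat.le_floor_iff (by linarith)).1 hp.1.2⟩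
  have hdiff : Chebyshev.theta (4 * Q) - Chebyshev.theta Q ≤ P.card * Real.log (4 * Q) := by
    have hfl : ⌊Q⌋₊ ≤ ⌊4 * Q⌋₊ := Nat.floor_le_floor (by linarith)
    have : Chebyshev.theta (4 * Q) = Chebyshev.theta Q + ∑ p ∈ P, Real.log p := by
      unfold Chebyshev.theta
      rw [← Ioc_union_Ioc_eq_Ioc (Nat.zero_le _) hfl, filter_union, sum_union]
      exact disjoint_filter_filter (Ioc_disjoint_Ioc_of_le le_rfl)
    rw [this, add_sub_cancel_left, ← nsmul_eq_mul]
    refine sum_le_card_nsmul _ _ _ fun p hp => ?_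
    obtain ⟨h1, -, h3⟩ := hmem p hp
    exact Real.log_le_log (by exact_mod_cast h1.pos) h3
  have hlogpos : 0 < Real.log (4 * Q) := Real.log_pos (by linarith)
  have hMlog : M * Real.log (4 * Q) ≤ 0.6 * Q := by
    rcases le_total (Real.log (4 * Q)) (4 * Real.log (2 * M)) with h | h
    · have : (M:ℝ) * Real.log (4 * Q) ≤ M * (4 * Real.log (2 * M)) := by gcongr
      have h0 : 0 ≤ (M:ℝ) * Real.log (2 * M) := mul_nonneg (by linarith) (by linarith)
      nlinarith
    · set y := √(√(4 * Q))
      have hy : 0 < y := by positivity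
      have hy2 : y ^ 2 = √(4 * Q) := Real.sq_sqrt (by positivity)
      have hy4 : y ^ 4 = 4 * Q := by
        rw [show y ^ 4 = (y ^ 2) ^ 2 by ring, hy2, Real.sq_sqrt (by positivity)]
      have hlog : Real.log (4 * Q) = 4 * Real.log y := by
        rw [← hy4, Real.log_pow]; norm_num
      have hMy : 2 * (M:ℝ) ≤ y := by
        rw [← Real.log_le_log_iff (by linarith) hy]; linarith
      have hly : Real.log y ≤ y := (Real.log_le_sub_one_of_pos hy).trans (by linarith)
      have h20 : 20 ≤ y ^ 2 := by
        rw [hy2]; exact Real.le_sqrt_of_sq_le (by linarith)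
      rw [hlog]
      have : (M:ℝ) * (4 * Real.log y) ≤ (y / 2) * (4 * y) := by
        have := Real.log_nonneg (show 1 ≤ y by nlinarith)
        gcongr; linarith
      nlinarith
  have hcard : M ≤ P.card := by
    have : (M:ℝ) ≤ P.card := by
      refine le_of_mul_le_mul_right ?_ hlogpos
      nlinarith
    exact_mod_cast this
  obtain ⟨S, hS, hSc⟩ := exists_subset_card_eq hcard
  exact ⟨S, hSc, fun p hp => hmem p (hS hp)⟩

lemma div_sub_one_le_card_multiples {X : ℝ} {d : ℕ} (hd : 0 < d) :
    X / d - 1 ≤ ({n ∈ Icc ⌈X⌉ ⌊2 * X⌋ | (d : ℤ) ∣ n}.card : ℝ) := by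
  have hd' : (0:ℝ) < d := by exact_mod_cast hd
  have hsub : (Icc ⌈X / d⌉ ⌊2 * X / d⌋).image (fun m : ℤ => (d : ℤ) * m) ⊆
      {n ∈ Icc ⌈X⌉ ⌊2 * X⌋ | (d : ℤ) ∣ n} := by
    intro n hn
    simp only [mem_image, mem_Icc, Int.ceil_le, Int.le_floor, mem_filter] at hn ⊢
    obtain ⟨m, ⟨h1, h2⟩, rfl⟩ := hn
    rw [div_le_iff₀ hd'] at h1
    rw [le_div_iff₀ hd'] at h2
    push_cast
    exact ⟨⟨by linarith, by linarith⟩, dvd_mul_right _ _⟩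
  have hc := card_le_card hsub
  rw [card_image_of_injective _ (mul_right_injective₀ (by exact_mod_cast hd.ne')),
    Int.card_Icc] at hc
  have h1 : (⌊2 * X / d⌋ + 1 - ⌈X / d⌉ : ℤ) ≤
      ({n ∈ Icc ⌈X⌉ ⌊2 * X⌋ | (d : ℤ) ∣ n}.card : ℤ) :=
    (Int.self_le_toNat _).trans (by exact_mod_cast hc)
  have h2 : ((⌊2 * X / d⌋ + 1 - ⌈X / d⌉ : ℤ) : ℝ) ≤
      ({n ∈ Icc ⌈X⌉ ⌊2 * X⌋ | (d : ℤ) ∣ n}.card : ℝ) := by exact_mod_cast h1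
  push_cast at h2
  have h3 := Int.lt_floor_add_one (2 * X / d)
  have h4 := Int.ceil_lt_add_one (X / d)
  have h5 : 2 * X / d = 2 * (X / d) := by ring
  linarith

lemma card_multiples_le {X : ℝ} (hX : 0 < X) {d : ℕ} (hd : 0 < d) :
    ({n ∈ Icc ⌈X⌉ ⌊2 * X⌋ | (d : ℤ) ∣ n}.card : ℝ) ≤ 2 * X / d := by
  have hd' : (0:ℝ) < d := by exact_mod_cast hd
  have hsub : {n ∈ Icc ⌈X⌉ ⌊2 * X⌋ | (d : ℤ) ∣ n} ⊆
      (Icc 1 ⌊2 * X / d⌋).image (fun m : ℤ => (d : ℤ) * m) := by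
    intro n hn
    simp only [mem_image, mem_Icc, Int.ceil_le, Int.le_floor, mem_filter] at hn ⊢
    obtain ⟨⟨h1, h2⟩, m, rfl⟩ := hn
    push_cast at h1 h2
    refine ⟨m, ⟨?_, ?_⟩, rfl⟩
    · have : (0:ℝ) < m := pos_of_mul_pos_right (hX.trans_le h1) hd'.le
      exact_mod_cast this
    · rw [le_div_iff₀ hd']; linarith
  have hc := (card_le_card hsub).trans card_image_le
  rw [Int.card_Icc, add_sub_cancel_right] at hc
  have hc' : ({n ∈ Icc ⌈X⌉ ⌊2 * X⌋ | (d : ℤ) ∣ n}.card : ℤ) ≤ ⌊2 * X / d⌋ := by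
    have : 0 ≤ ⌊2 * X / d⌋ := Int.floor_nonneg.2 (by positivity)
    omega
  exact (by exact_mod_cast hc' : (_ : ℝ) ≤ (⌊2 * X / d⌋ : ℝ)).trans (Int.floor_le _)

/-- Integers in `[X, 2X]` divisible by some element of `S`. -/
noncomputable def multiplesOf (S : Finset ℕ) (X : ℝ) : Finset ℤ :=
  {n ∈ Icc ⌈X⌉ ⌊2 * X⌋ | ∃ p ∈ S, (p : ℤ) ∣ n}

/-- Integers in `[X, 2X]` divisible by `p` and by no other element of `S`. -/
noncomputable def exclusiveMultiplesOf (S : Finset ℕ) (X : ℝ) (p : ℕ) : Finset ℤ :=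
  {n ∈ Icc ⌈X⌉ ⌊2 * X⌋ | (p : ℤ) ∣ n ∧ ∀ q ∈ S, (q : ℤ) ∣ n → q = p}

lemma card_multiplesOf_le {S : Finset ℕ} {X Q : ℝ} (hX : 0 < X) (hQ : 0 < Q)
    (hS : ∀ p ∈ S, Q < (p : ℝ)) :
    ((multiplesOf S X).card : ℝ) ≤ S.card * (2 * X / Q) := by
  have hsub : multiplesOf S X ⊆
      S.biUnion fun p => {n ∈ Icc ⌈X⌉ ⌊2 * X⌋ | (p : ℤ) ∣ n} := by
    intro n hn
    simp only [multiplesOf, mem_filter, mem_biUnion] at hn ⊢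
    obtain ⟨h1, p, hp, h2⟩ := hn
    exact ⟨p, hp, h1, h2⟩
  have h1 := (card_le_card hsub).trans card_biUnion_le
  calc ((multiplesOf S X).card : ℝ)
      ≤ ∑ p ∈ S, ({n ∈ Icc ⌈X⌉ ⌊2 * X⌋ | (p : ℤ) ∣ n}.card : ℝ) := by exact_mod_cast h1
    _ ≤ S.card • (2 * X / Q) := by
      refine sum_le_card_nsmul _ _ _ fun p hp => ?_
      have hp0 : (0:ℝ) < p := hQ.trans (hS p hp)
      refine (card_multiples_le hX (by exact_mod_cast hp0)).trans ?_
      have := (hS p hp).le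
      gcongr
    _ = _ := nsmul_eq_mul _ _

lemma le_card_exclusiveMultiplesOf {S : Finset ℕ} {X Q : ℝ} (hX : 0 < X) (hQ : 0 < Q)
    (hS : ∀ p ∈ S, p.Prime ∧ Q < p ∧ (p : ℝ) ≤ 4 * Q) (hSQ : 32 * S.card ≤ Q) (hQX : 8 * Q ≤ X)
    {p : ℕ} (hp : p ∈ S) : X / (16 * Q) ≤ ((exclusiveMultiplesOf S X p).card : ℝ) := by
  obtain ⟨hpp, hQp, hp4⟩ := hS p hp
  have hsub : {n ∈ Icc ⌈X⌉ ⌊2 * X⌋ | (p : ℤ) ∣ n} ⊆ exclusiveMultiplesOf S X p ∪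
      S.biUnion fun q => {n ∈ Icc ⌈X⌉ ⌊2 * X⌋ | q ≠ p ∧ ((p * q : ℕ) : ℤ) ∣ n} := by
    intro n hn
    simp only [exclusiveMultiplesOf, mem_filter, mem_union, mem_biUnion] at hn ⊢
    by_cases h : ∀ q ∈ S, (q : ℤ) ∣ n → q = p
    · exact Or.inl ⟨hn.1, hn.2, h⟩
    · push Not at h
      obtain ⟨q, hq, hqn, hne⟩ := h
      refine Or.inr ⟨q, hq, hn.1, hne, ?_⟩
      push_cast
      refine IsCoprime.mul_dvd ?_ hn.2 hqn
      exact Nat.isCoprime_iff_coprime.2 ((Nat.coprime_primes hpp (hS q hq).1).2 hne.symm)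
  have h1 := ((card_le_card hsub).trans (card_union_le _ _)).trans
    (Nat.add_le_add_left card_biUnion_le _)
  have h2 : ∑ q ∈ S, ({n ∈ Icc ⌈X⌉ ⌊2 * X⌋ | q ≠ p ∧ ((p * q : ℕ) : ℤ) ∣ n}.card : ℝ) ≤
      S.card • (2 * X / (Q * Q)) := by
    refine sum_le_card_nsmul _ _ _ fun q hq => ?_
    have hq0 : 0 < p * q := Nat.mul_pos hpp.pos (hS q hq).1.pos
    calc _ ≤ ({n ∈ Icc ⌈X⌉ ⌊2 * X⌋ | ((p * q : ℕ) : ℤ) ∣ n}.card : ℝ) := by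
          gcongr with n hn
          exact fun h => h.2
      _ ≤ _ := card_multiples_le hX hq0
      _ ≤ _ := by
        push_cast
        have := (hS q hq).2.1.le
        gcongr
  have h3 := div_sub_one_le_card_multiples (X := X) hpp.pos
  have h4 : ({n ∈ Icc ⌈X⌉ ⌊2 * X⌋ | (p : ℤ) ∣ n}.card : ℝ) ≤
      (exclusiveMultiplesOf S X p).card +
      ∑ q ∈ S, ({n ∈ Icc ⌈X⌉ ⌊2 * X⌋ | q ≠ p ∧ ((p * q : ℕ) : ℤ) ∣ n}.card : ℝ) := by
    exact_mod_cast h1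
  have h5 : X / (4 * Q) ≤ X / p := by
    have := hpp.pos
    gcongr
  have h6 : 1 ≤ X / (8 * Q) := (one_le_div (by linarith)).2 hQX
  have h7 : S.card • (2 * X / (Q * Q)) ≤ X / (16 * Q) := by
    rw [nsmul_eq_mul]
    calc S.card * (2 * X / (Q * Q)) = (32 * S.card) * (X / (16 * (Q * Q))) := by ring
      _ ≤ Q * (X / (16 * (Q * Q))) := by gcongr
      _ = _ := by field_simp
  have h8 : X / (4 * Q) = 4 * (X / (16 * Q)) := by field_simp; norm_num
  have h9 : X / (8 * Q) = 2 * (X / (16 * Q)) := by field_simp; norm_num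
  linarith

lemma exclusiveMultiplesOf_subset {S : Finset ℕ} {X : ℝ} {p : ℕ} (hp : p ∈ S) :
    exclusiveMultiplesOf S X p ⊆ multiplesOf S X := by
  intro n hn
  simp only [exclusiveMultiplesOf, multiplesOf, mem_filter] at hn ⊢
  exact ⟨hn.1, p, hp, hn.2.1⟩

lemma disjoint_exclusiveMultiplesOf {S : Finset ℕ} {X : ℝ} {p q : ℕ} (hp : p ∈ S) (hpq : p ≠ q) :
    Disjoint (exclusiveMultiplesOf S X p) (exclusiveMultiplesOf S X q) := by
  refine disjoint_left.2 fun n hn hn' => hpq ?_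
  simp only [exclusiveMultiplesOf, mem_filter] at hn hn'
  exact hn'.2.2 p hp hn.2.1

lemma le_card_multiplesOf {S : Finset ℕ} {X t : ℝ}
    (ht : ∀ p ∈ S, t ≤ ((exclusiveMultiplesOf S X p).card : ℝ)) :
    S.card * t ≤ ((multiplesOf S X).card : ℝ) := by
  have h1 : S.biUnion (exclusiveMultiplesOf S X) ⊆ multiplesOf S X :=
    biUnion_subset.2 fun p hp => exclusiveMultiplesOf_subset hp
  have h2 := card_le_card h1
  rw [card_biUnion fun p hp q _ hpq => disjoint_exclusiveMultiplesOf hp hpq] at h2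
  rw [← nsmul_eq_mul]
  refine (card_nsmul_le_sum S _ t ht).trans ?_
  exact_mod_cast h2

lemma sum_prod_card_le_card_filter {ι : Type*} [Fintype ι] [DecidableEq ι] [Nonempty ι]
    {S : Finset ℕ} {X : ι → ℝ} {P : (ι → ℤ) → Prop} [DecidablePred P]
    (hP : ∀ p ∈ S, ∀ a : ι → ℤ, (∀ i, X i ≤ a i ∧ a i ≤ 2 * X i) → (∀ i, (p : ℤ) ∣ a i) → P a) :
    ∑ p ∈ S, ∏ i, (exclusiveMultiplesOf S (X i) p).card ≤
      ((Fintype.piFinset fun i => multiplesOf S (X i)).filter P).card := by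
  have hdisj : ∀ p ∈ S, ∀ q ∈ S, p ≠ q →
      Disjoint (Fintype.piFinset fun i => exclusiveMultiplesOf S (X i) p)
        (Fintype.piFinset fun i => exclusiveMultiplesOf S (X i) q) := by
    intro p hp q _ hpq
    refine disjoint_left.2 fun a ha ha' => ?_
    obtain ⟨i⟩ := ‹Nonempty ι›
    exact disjoint_left.1 (disjoint_exclusiveMultiplesOf hp hpq)
      (Fintype.mem_piFinset.1 ha i) (Fintype.mem_piFinset.1 ha' i)
  calc _ = (S.biUnion fun p => Fintype.piFinset fun i => exclusiveMultiplesOf S (X i) p).card := by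
        rw [card_biUnion hdisj]
        simp only [Fintype.card_piFinset]
    _ ≤ _ := by
        refine card_le_card (biUnion_subset.2 fun p hp a ha => ?_)
        rw [Fintype.mem_piFinset] at ha
        refine mem_filter.2 ⟨Fintype.mem_piFinset.2 fun i =>
          exclusiveMultiplesOf_subset hp (ha i), hP p hp a (fun i => ?_) fun i => ?_⟩
        · have := ha i
          simp only [exclusiveMultiplesOf, mem_filter, mem_Icc, Int.ceil_le, Int.le_floor] at this
          exact this.1
        · exact (mem_filter.1 (ha i)).2.1

lemma lcm_mul_pow_le_prod {k : ℕ} (hk : 1 ≤ k) {a : Fin k → ℤ} {p : ℕ} (hp : 0 < p)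
    (ha : ∀ i, 0 < a i) (hd : ∀ i, (p : ℤ) ∣ a i) :
    univ.lcm a * (p : ℤ) ^ (k - 1) ≤ ∏ i, a i := by
  choose b hb using hd
  have hp' : (0:ℤ) < p := by exact_mod_cast hp
  have hbpos : ∀ i, 0 < b i := fun i => pos_of_mul_pos_right (hb i ▸ ha i) hp'.le
  have h1 : univ.lcm a ∣ p * ∏ i, b i := by
    refine Finset.lcm_dvd fun i _ => ?_
    rw [hb i]
    exact mul_dvd_mul_left _ (dvd_prod_of_mem _ (mem_univ i))
  have h2 := Int.le_of_dvd (mul_pos hp' (prod_pos fun i _ => hbpos i)) h1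
  calc univ.lcm a * (p : ℤ) ^ (k - 1) ≤ (p * ∏ i, b i) * (p : ℤ) ^ (k - 1) := by gcongr
    _ = (p : ℤ) ^ (k - 1 + 1) * ∏ i, b i := by ring
    _ = ∏ i, a i := by
      rw [Nat.sub_add_cancel hk, prod_congr rfl fun i _ => hb i, prod_mul_distrib, prod_const,
        card_univ, Fintype.card_fin]

lemma lcm_le_of_common_dvd {k : ℕ} (hk : 2 ≤ k) {X : Fin k → ℝ} {L Q : ℝ} (hX : ∀ i, 0 < X i)
    (hL : 0 < L) (hQ0 : 0 < Q) (hQ : Q ^ (k - 1) = 4 ^ (k - 1) * ((∏ i, X i) / L)) {p : ℕ}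
    (hp : Q < p) {a : Fin k → ℤ} (ha : ∀ i, X i ≤ a i ∧ a i ≤ 2 * X i)
    (hd : ∀ i, (p : ℤ) ∣ a i) : ((univ.lcm a : ℤ) : ℝ) ≤ L := by
  have hp0 : 0 < p := by exact_mod_cast hQ0.trans hp
  have hPpos : 0 < ∏ i, X i := prod_pos fun i _ => hX i
  have h1 := lcm_mul_pow_le_prod (by omega) hp0
    (fun i => by exact_mod_cast (hX i).trans_le (ha i).1) hd
  have h2 : ((univ.lcm a : ℤ) : ℝ) * (p : ℝ) ^ (k - 1) ≤ ∏ i, (a i : ℝ) := by exact_mod_cast h1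
  have h3 : ∏ i, (a i : ℝ) ≤ ∏ i, (2 * X i) :=
    prod_le_prod (fun i _ => (hX i).le.trans (ha i).1) fun i _ => (ha i).2
  rw [prod_mul_distrib, prod_const, card_univ, Fintype.card_fin] at h3
  have h4 : (0:ℝ) ≤ ((univ.lcm a : ℤ) : ℝ) := by
    have : (0:ℤ) ≤ univ.lcm a := Int.nonneg_of_normalize_eq_self Finset.normalize_lcm
    exact_mod_cast this
  have h5 : ((univ.lcm a : ℤ) : ℝ) * Q ^ (k - 1) ≤ 2 ^ k * ∏ i, X i := by
    refine le_trans ?_ (h2.trans h3)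
    gcongr
  rw [hQ] at h5
  have h6 : (2:ℝ) ^ k ≤ 4 ^ (k - 1) := by
    rw [show (4:ℝ) = 2 ^ 2 by norm_num, ← pow_mul]
    exact pow_le_pow_right₀ (by norm_num) (by omega)
  have h7 : ((univ.lcm a : ℤ) : ℝ) * (4 ^ (k - 1) * ((∏ i, X i) / L)) =
      (((univ.lcm a : ℤ) : ℝ) / L) * (4 ^ (k - 1) * ∏ i, X i) := by ring
  rw [h7] at h5
  have h8 : (((univ.lcm a : ℤ) : ℝ) / L) * (4 ^ (k - 1) * ∏ i, X i) ≤
      1 * (4 ^ (k - 1) * ∏ i, X i) := by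
    rw [one_mul]; refine h5.trans ?_; gcongr
  exact (div_le_one hL).1 (le_of_mul_le_mul_right h8 (by positivity))

/-- The density estimate `δ (2M/Q)ᵏ ≤ M / (16 Q)ᵏ`, with the product of the `X i` factored in. -/
lemma density_mul_prod_le {k : ℕ} (hk : 2 ≤ k) {X : Fin k → ℝ} {δ M Q : ℝ} (hX : ∀ i, 0 < X i)
    (hM : 0 < M) (hQ : 0 < Q) (hδM : δ * (1024 * M) ^ (k - 1) ≤ 1) :
    δ * ∏ i, (M * (2 * X i / Q)) ≤ M * ∏ i, (X i / (16 * Q)) := by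
  have h1 : ∏ i, (M * (2 * X i / Q)) = (32 * M) ^ k * ∏ i, (X i / (16 * Q)) := by
    have : (32 * M) ^ k = ∏ _i : Fin k, (32 * M) := by simp
    rw [this, ← prod_mul_distrib]
    refine prod_congr rfl fun i _ => ?_
    ring
  have h2 : (0:ℝ) < ∏ i, (X i / (16 * Q)) := prod_pos fun i _ => by have := hX i; positivity
  obtain ⟨n, rfl⟩ : ∃ n, k = n + 2 := ⟨k - 2, by omega⟩
  rw [h1, ← mul_assoc]
  refine mul_le_mul_of_nonneg_right ?_ h2.le
  have h3 : δ * (1024 * M) ^ (n + 1) = δ * (32 * M) ^ (n + 2) * (32 ^ n / M) := by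
    rw [show (1024:ℝ) * M = 32 * (32 * M) by ring, mul_pow]
    field_simp
    ring
  rw [show n + 2 - 1 = n + 1 by omega, h3] at hδM
  have h4 : (1:ℝ) ≤ 32 ^ n := one_le_pow₀ (by norm_num)
  rcases le_total (δ * (32 * M) ^ (n + 2)) 0 with h | h
  · linarith
  · have : δ * (32 * M) ^ (n + 2) * (1 / M) ≤ 1 := by
      refine le_trans ?_ hδM; gcongr
    rwa [mul_one_div, div_le_one hM] at this

lemma size_bound_eq {n : ℕ} {x l ρ : ℝ} (hl : 0 < l) (hρ : 0 < ρ) :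
    1 / 131072 ^ (n + 1) * x ^ (n + 1) * l ^ (n + 1) / ρ =
      (x / 2048) ^ (n + 1) * ((1 / (16 * (4 * (ρ / l)))) ^ (n + 1) * ρ ^ n) := by
  rw [← mul_assoc, ← mul_pow,
    show x / 2048 * (1 / (16 * (4 * (ρ / l)))) = 1 / 131072 * x * l / ρ by field_simp; ring,
    div_pow, mul_pow, mul_pow, one_div_pow]
  field_simp
  ring

theorem lcm_bound_sharpness (k : ℕ) (hk : 2 ≤ k) :
    ∃ c C K : ℝ, 0 < c ∧ 0 < C ∧ 0 < K ∧
      ∀ (δ : ℝ) (X : Fin k → ℝ) (L : ℝ),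
        δ ∈ Set.Ioc (0:ℝ) 1 → (∀ i, 1 ≤ X i) → 1 ≤ L →
        ∀ (M : ℤ) (Q : ℝ),
          M = ⌈c * δ ^ (-(1 : ℝ) / ((k : ℝ) - 1))⌉ →
          Q = C * ((∏ i, X i) / L) ^ ((1 : ℝ) / ((k : ℝ) - 1)) →
          K * (M : ℝ) * Real.log (2 * (M : ℝ)) ≤ Q →
          (∀ i, K * Q ≤ X i) →
          ∃ A : Fin k → Finset ℤ,
            (∀ i, ∀ a ∈ A i, X i ≤ (a : ℝ) ∧ (a : ℝ) ≤ 2 * X i) ∧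
            δ * ∏ i, ((A i).card : ℝ) ≤
              (((Fintype.piFinset A).filter
                (fun a => ((Finset.univ.lcm a : ℤ) : ℝ) ≤ L)).card : ℝ) ∧
            (1 / K) * δ ^ (-(k : ℝ) / ((k : ℝ) - 1)) * L ^ ((k : ℝ) / ((k : ℝ) - 1)) /
                (∏ i, X i) ^ ((1 : ℝ) / ((k : ℝ) - 1)) ≤
              ∏ i, ((A i).card : ℝ) := by
  obtain ⟨K₀, hK₀, hprimes⟩ := exists_primes_card_eq
  have hB : (0:ℝ) < (131072:ℝ) ^ k := by positivity
  refine ⟨1 / 2048, 4, K₀ + 64 + 131072 ^ k, by norm_num, by norm_num, by positivity, ?_⟩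
  set K : ℝ := K₀ + 64 + 131072 ^ k with hKdef
  rintro δ X L ⟨hδ0, hδ1⟩ hX hL M Q hM hQ hMQ hQX
  have hX0 : ∀ i, 0 < X i := fun i => one_pos.trans_le (hX i)
  have hL0 : 0 < L := one_pos.trans_le hL
  have hP : 0 < ∏ i, X i := prod_pos fun i _ => hX0 i
  have hk0 : k ≠ 0 := by omega
  have : Nonempty (Fin k) := ⟨⟨0, by omega⟩⟩
  obtain ⟨n, hn⟩ : ∃ n, n = k - 1 := ⟨_, rfl⟩
  have hn0 : n ≠ 0 := by omega
  have hkn : (k:ℝ) - 1 = n := by rw [hn, Nat.cast_sub (by omega)]; simp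
  rw [hkn] at hM hQ ⊢
  have root_pow : ∀ y : ℝ, 0 ≤ y → (y ^ ((1:ℝ) / n)) ^ n = y := fun y hy => by
    rw [one_div, Real.rpow_inv_natCast_pow hy hn0]
  set x := δ ^ (-(1:ℝ) / n) with hx
  have hx0 : 0 < x := Real.rpow_pos_of_pos hδ0 _
  have hxn : δ * x ^ n = 1 := by
    have : x = (δ⁻¹) ^ ((1:ℝ) / n) := by
      rw [hx, neg_div, Real.rpow_neg hδ0.le, Real.inv_rpow hδ0.le]
    rw [this, root_pow _ (inv_nonneg.2 hδ0.le), mul_inv_cancel₀ hδ0.ne']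
  set l := L ^ ((1:ℝ) / n)
  set ρ := (∏ i, X i) ^ ((1:ℝ) / n)
  have hl0 : 0 < l := Real.rpow_pos_of_pos hL0 _
  have hρ0 : 0 < ρ := Real.rpow_pos_of_pos hP _
  have hρn : ρ ^ n = ∏ i, X i := root_pow _ hP.le
  have hQ' : Q = 4 * (ρ / l) := by rw [hQ, Real.div_rpow hP.le hL0.le]
  have hQ0 : 0 < Q := by rw [hQ']; positivity
  have hQn : Q ^ (k - 1) = 4 ^ (k - 1) * ((∏ i, X i) / L) := by
    rw [← hn, hQ, mul_pow, root_pow _ (by positivity)]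
  have hxk : δ ^ (-(k:ℝ) / n) = x ^ k := by
    rw [hx, ← Real.rpow_mul_natCast hδ0.le]; congr 1; ring
  have hlk : L ^ ((k:ℝ) / n) = l ^ k := by
    rw [← Real.rpow_mul_natCast hL0.le]; congr 1; ring
  rw [hxk, hlk]
  have hMpos : 0 < M := by rw [hM]; exact Int.ceil_pos.2 (by positivity)
  obtain ⟨m, hm⟩ : ∃ m : ℕ, (m : ℤ) = M := ⟨M.toNat, Int.toNat_of_nonneg hMpos.le⟩
  have hmR : (M : ℝ) = m := by rw [← hm]; simp
  have hm1 : 1 ≤ m := by omega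
  have hm1' : (1:ℝ) ≤ m := by exact_mod_cast hm1
  have hmx : x / 2048 ≤ m := by
    rw [← hmR, hM]; exact le_trans (by linarith) (Int.le_ceil _)
  rw [hmR] at hMQ
  have hlog : (0.5:ℝ) ≤ Real.log (2 * m) := by
    have := Real.log_le_log (by norm_num : (0:ℝ) < 2) (show (2:ℝ) ≤ 2 * m by linarith)
    linarith [Real.log_two_gt_d9]
  obtain ⟨S, hSm, hS⟩ := hprimes m Q hm1 (by
    refine le_trans ?_ hMQ
    have : K₀ ≤ K := by linarith
    gcongr)
  have hSQ : 32 * (S.card : ℝ) ≤ Q := by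
    rw [hSm]
    refine le_trans ?_ hMQ
    calc 32 * (m:ℝ) = 64 * m * 0.5 := by ring
      _ ≤ _ := by
        have : 64 ≤ K := by linarith
        gcongr
  have hQX' : ∀ i, 8 * Q ≤ X i := fun i => le_trans (by gcongr; linarith) (hQX i)
  have hE : ∀ p ∈ S, ∀ i, X i / (16 * Q) ≤ ((exclusiveMultiplesOf S (X i) p).card : ℝ) :=
    fun p hp i => le_card_exclusiveMultiplesOf (hX0 i) hQ0 hS hSQ (hQX' i) hp
  have hgood : ∀ p ∈ S, ∀ a : Fin k → ℤ, (∀ i, X i ≤ a i ∧ a i ≤ 2 * X i) →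
      (∀ i, (p : ℤ) ∣ a i) → ((univ.lcm a : ℤ) : ℝ) ≤ L :=
    fun p hp a ha hd => lcm_le_of_common_dvd hk hX0 hL0 hQ0 hQn (hS p hp).2.1 ha hd
  have hmem : ∀ i, ∀ a ∈ multiplesOf S (X i), X i ≤ (a : ℝ) ∧ (a : ℝ) ≤ 2 * X i := by
    intro i a ha
    simp only [multiplesOf, mem_filter, mem_Icc, Int.ceil_le, Int.le_floor] at ha
    exact ha.1
  refine ⟨fun i => multiplesOf S (X i), hmem, ?_, ?_⟩
  · rcases hm1.eq_or_lt with h | h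
    · obtain ⟨p, rfl⟩ := card_eq_one.1 (hSm.trans h.symm)
      rw [filter_true_of_mem, Fintype.card_piFinset]
      · rw [Nat.cast_prod]
        exact mul_le_of_le_one_left (prod_nonneg fun _ _ => Nat.cast_nonneg _) hδ1
      · intro a ha
        rw [Fintype.mem_piFinset] at ha
        refine hgood p (mem_singleton_self p) a (fun i => hmem i _ (ha i)) fun i => ?_
        simpa using (mem_filter.1 (ha i)).2
    · have hm2 : (2:ℝ) ≤ m := by exact_mod_cast h
      have hmx' : 1024 * (m:ℝ) ≤ x := by
        have h1 : (m:ℝ) < 1 / 2048 * x + 1 := by rw [← hmR, hM]; exact Int.ceil_lt_add_one _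
        linarith
      have hsum := sum_prod_card_le_card_filter hgood
      calc δ * ∏ i, ((multiplesOf S (X i)).card : ℝ)
          ≤ δ * ∏ i, ((m:ℝ) * (2 * X i / Q)) := by
            gcongr with i
            rw [← hSm]
            exact card_multiplesOf_le (hX0 i) hQ0 fun p hp => (hS p hp).2.1
        _ ≤ m * ∏ i, (X i / (16 * Q)) := by
            refine density_mul_prod_le hk hX0 (by linarith) hQ0 ?_
            rw [← hn, ← hxn]
            gcongr
        _ ≤ ∑ p ∈ S, ∏ i, ((exclusiveMultiplesOf S (X i) p).card : ℝ) := by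
            rw [← hSm, ← nsmul_eq_mul]
            refine card_nsmul_le_sum _ _ _ fun p hp => ?_
            exact prod_le_prod (fun i _ => by have := hX0 i; positivity) fun i _ => hE p hp i
        _ ≤ _ := by exact_mod_cast hsum
  · calc 1 / K * x ^ k * l ^ k / ρ ≤ 1 / 131072 ^ k * x ^ k * l ^ k / ρ := by
          gcongr
          linarith
      _ = (x / 2048) ^ k * ((1 / (16 * Q)) ^ k * ∏ i, X i) := by
          rw [hQ', ← hρn, show k = n + 1 by omega]
          exact size_bound_eq hl0 hρ0
      _ ≤ (m:ℝ) ^ k * ((1 / (16 * Q)) ^ k * ∏ i, X i) := by gcongr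
      _ = ∏ i, ((m:ℝ) * (X i / (16 * Q))) := by
          simp only [prod_mul_distrib, div_eq_mul_inv, prod_const, card_univ, Fintype.card_fin]
          ring
      _ ≤ _ := by
          refine prod_le_prod (fun i _ => by have := hX0 i; positivity) fun i _ => ?_
          rw [← hSm]
          exact le_card_multiplesOf fun p hp => hE p hp i
end
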